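/- Fix k ≥ 3 and let (q_m)_{m≥1} be a strictly increasing sequence of prime powers q_m = p_m^{e_m}. For each m let S(k,q_m) = S(k,q_m; f_{3,m},g_{3,m},…,f_{k,m},g_{k,m}) be as in the definition, set d_f^{(m)} = max_{3≤i≤k} deg(f_{i,m}) and d_g^{(m)} = max_{3≤i≤k} deg(g_{i,m}), and assume d_f^{(m)} ≥ 1, 1 ≤ d_g^{(m)} < p_m, d_f^{(m)}/q_m → 0, d_g^{(m)}/√q_m → 0 as m → ∞, and that for every m at least one of the following holds: (1) the polynomials 1, X, f_{3,m}, …, f_{k,m} are linearly independent over F_{q_m} and each g_{i,m} has a nonzero coefficient of X; (2) the polynomials f_{3,m}, …, f_{k,m} are linearly independent over F_{q_m} and there exists j with 2 ≤ j ≤ d_g^{(m)} such that the coefficient of X^j in g_{i,m} is nonzero for every 3 ≤ i ≤ k. Then every S(k,q_m) is connected and λ_2(S(k,q_m))/q_m^2 → 0 as m → ∞. -/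

import Mathlib

/-- The list of eigenvalues (with multiplicity) of a Hermitian real matrix,
sorted in increasing order. -/
noncomputable def eigSorted {V : Type} [Fintype V] [DecidableEq V] {A : Matrix V V ℝ}
    (hA : A.IsHermitian) : List ℝ :=
  (Finset.univ.val.map hA.eigenvalues).sort (· ≤ ·)

/-- The second largest eigenvalue (with multiplicity) of a Hermitian real matrix on at least
two indices: the entry at position `card V - 2` of the increasingly sorted list of its
`card V` eigenvalues. -/
noncomputable def secondLargestEig {V : Type} [Fintype V] [DecidableEq V] {A : Matrix V V ℝ}
    (hA : A.IsHermitian) : ℝ :=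
  (eigSorted hA).getD (Fintype.card V - 2) 0

open Polynomial

/-- Bivariate polynomials of weighted degree at most `W`, where the inner variable has weight `p`
and the outer variable has weight `d`. -/
def wtLE (K : Type*) [Field K] (p d W : ℕ) : Submodule K K[X][X] where
  carrier := {P | ∀ v u, (P.coeff v).coeff u ≠ 0 → p * u + d * v ≤ W}
  add_mem' := by
    intro P Q hP hQ v u h
    by_cases h1 : (P.coeff v).coeff u = 0
    · exact hQ v u (by simpa [h1] using h)
    · exact hP v u h1
  zero_mem' := by simp
  smul_mem' := by
    intro c P hP v u h
    refine hP v u fun h0 => h ?_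
    simp [h0]

section wtLE
variable {K : Type*} [Field K] {p d W : ℕ}

theorem wtLE_mono {W' : ℕ} (h : W ≤ W') {P : K[X][X]} (hP : P ∈ wtLE K p d W) :
    P ∈ wtLE K p d W' := fun v u hu => (hP v u hu).trans h

theorem coeff_coeff_eq_zero_of_mem_wtLE {P : K[X][X]} (hP : P ∈ wtLE K p d W) {v u : ℕ}
    (h : W < p * u + d * v) : (P.coeff v).coeff u = 0 := by
  by_contra h0
  exact absurd (hP v u h0) (by omega)

theorem mul_mem_wtLE {W' : ℕ} {P Q : K[X][X]} (hP : P ∈ wtLE K p d W)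
    (hQ : Q ∈ wtLE K p d W') : P * Q ∈ wtLE K p d (W + W') := by
  intro v u h
  rw [coeff_mul, finsetSum_coeff] at h
  obtain ⟨⟨v₁, v₂⟩, hv, h⟩ := Finset.exists_ne_zero_of_sum_ne_zero h
  rw [coeff_mul] at h
  obtain ⟨⟨u₁, u₂⟩, hu, h⟩ := Finset.exists_ne_zero_of_sum_ne_zero h
  rw [Finset.HasAntidiagonal.mem_antidiagonal] at hv hu
  have h1 := hP v₁ u₁ (left_ne_zero_of_mul h)
  have h2 := hQ v₂ u₂ (right_ne_zero_of_mul h)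
  simp only at hv hu
  subst hv hu
  linarith

theorem C_mem_wtLE {a : K[X]} (h : p * a.natDegree ≤ W) : C a ∈ wtLE K p d W := by
  intro v u hu
  rw [coeff_C] at hu
  split_ifs at hu with hv
  · subst hv
    have := le_natDegree_of_ne_zero hu
    nlinarith
  · simp at hu

theorem X_mem_wtLE : (X : K[X][X]) ∈ wtLE K p d d := by
  intro v u hu
  rw [coeff_X] at hu
  split_ifs at hu with hv
  · subst hv
    rw [coeff_one] at hu
    have : u = 0 := by by_contra h; simp [h] at hu
    subst this; omega
  · simp at hu

theorem pow_mem_wtLE {P : K[X][X]} (hP : P ∈ wtLE K p d W) (n : ℕ) :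
    P ^ n ∈ wtLE K p d (n * W) := by
  induction n with
  | zero => simpa using C_mem_wtLE (K := K) (p := p) (d := d) (W := 0) (a := 1) (by simp)
  | succ n ih =>
    rw [pow_succ]
    exact wtLE_mono (by linarith) (mul_mem_wtLE ih hP)

theorem modByMonic_mem_wtLE {m : K[X][X]} (hm : m.Monic) (hmw : m ∈ wtLE K p d (d * m.natDegree))
    {P : K[X][X]} (hP : P ∈ wtLE K p d W) : P %ₘ m ∈ wtLE K p d W := by
  induction hn : P.degree using WellFoundedLT.induction generalizing P with
  | _ n ih =>
    by_cases hlt : P.degree < m.degree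
    · rwa [(modByMonic_eq_self_iff hm).2 hlt]
    have hP0 : P ≠ 0 := by
      rintro rfl
      exact hlt (by rw [degree_zero, bot_lt_iff_ne_bot]; exact degree_ne_bot.2 hm.ne_zero)
    push Not at hlt
    have hdeg : m.natDegree ≤ P.natDegree := natDegree_le_natDegree hlt
    set T : K[X][X] := C P.leadingCoeff * X ^ (P.natDegree - m.natDegree) with hT
    have hlc : p * P.leadingCoeff.natDegree + d * P.natDegree ≤ W :=
      hP _ _ (leadingCoeff_ne_zero.2 (leadingCoeff_ne_zero.2 hP0))
    have hTw : T ∈ wtLE K p d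
        (p * P.leadingCoeff.natDegree + (P.natDegree - m.natDegree) * d) :=
      mul_mem_wtLE (C_mem_wtLE le_rfl) (pow_mem_wtLE X_mem_wtLE _)
    have hsum : p * P.leadingCoeff.natDegree + (P.natDegree - m.natDegree) * d +
        d * m.natDegree ≤ W := by
      obtain ⟨c, hc⟩ := Nat.exists_eq_add_of_le hdeg
      rw [hc] at hlc ⊢
      simp only [Nat.add_sub_cancel_left]
      linarith
    have hmT : T * m ∈ wtLE K p d W := wtLE_mono hsum (mul_mem_wtLE hTw hmw)
    have hsub : P - T * m ∈ wtLE K p d W := Submodule.sub_mem _ hP hmT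
    have hmod : P %ₘ m = (P - m * T) %ₘ m := by
      rw [sub_modByMonic, self_mul_modByMonic hm, sub_zero]
    rw [hmod]
    rw [mul_comm] at hsub
    exact ih _ (hn ▸ div_wf_lemma ⟨hlt, hP0⟩ hm) hsub rfl
end wtLE

section Stepanov
variable {K : Type*} [Field K] {p d : ℕ}

/-- The Artin–Schreier polynomial `Y ^ p - Y - f` over `K[X]`. -/
noncomputable def artinSchreier (p : ℕ) (f : K[X]) : K[X][X] := X ^ p - X - C f

theorem artinSchreier_natDegree (hp : 2 ≤ p) (f : K[X]) : (artinSchreier p f).natDegree = p := by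
  unfold artinSchreier
  rw [sub_sub]
  rw [natDegree_sub_eq_left_of_natDegree_lt]
  · simp
  · rw [natDegree_X_add_C, natDegree_X_pow]; omega

theorem artinSchreier_monic (hp : 2 ≤ p) (f : K[X]) : (artinSchreier p f).Monic := by
  unfold artinSchreier
  rw [sub_sub]
  refine monic_X_pow_sub ?_
  rw [degree_X_add_C]
  exact_mod_cast hp

theorem artinSchreier_mem_wtLE (hp : 2 ≤ p) (f : K[X]) :
    artinSchreier p f ∈ wtLE K p f.natDegree (f.natDegree * (artinSchreier p f).natDegree) := by
  rw [artinSchreier_natDegree hp]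
  refine Submodule.sub_mem _ (Submodule.sub_mem _ ?_ ?_) ?_
  · exact wtLE_mono (by rw [mul_comm]) (pow_mem_wtLE X_mem_wtLE p)
  · exact wtLE_mono (by nlinarith) X_mem_wtLE
  · exact C_mem_wtLE (by rw [mul_comm])

/-- The iterated trace `f + f ^ p + ⋯ + f ^ (p ^ (n - 1))`. -/
noncomputable def frobSum (p : ℕ) (f : K[X]) (n : ℕ) : K[X] := ∑ t ∈ Finset.range n, f ^ p ^ t

theorem frobSum_natDegree (hp : 2 ≤ p) {f : K[X]} (hf : 0 < f.natDegree) (n : ℕ) :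
    (frobSum p f (n + 1)).natDegree = p ^ n * f.natDegree := by
  induction n with
  | zero => simp [frobSum]
  | succ n ih =>
    rw [frobSum, Finset.sum_range_succ, ← frobSum, natDegree_add_eq_right_of_natDegree_lt]
    · rw [natDegree_pow]
    · rw [ih, natDegree_pow, pow_succ]
      have : 0 < p ^ n := by positivity
      nlinarith [mul_pos this hf]

theorem pow_pow_eq_add_eval_frobSum [Fact p.Prime] [CharP K p] (f : K[X]) {x y : K}
    (h : y ^ p - y = f.eval x) (n : ℕ) : y ^ p ^ n = y + (frobSum p f n).eval x := by
  induction n with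
  | zero => simp [frobSum]
  | succ n ih =>
    rw [frobSum, Finset.sum_range_succ, ← frobSum, eval_add, ← add_assoc, ← ih, eval_pow, ← h,
      sub_pow_char_pow, ← pow_mul, ← pow_succ']
    ring

theorem evalEval_modByMonic_artinSchreier (f : K[X]) {x y : K}
    (h : y ^ p - y = f.eval x) (P : K[X][X]) :
    (P %ₘ artinSchreier p f).evalEval x y = P.evalEval x y := by
  conv_rhs => rw [← modByMonic_add_div P (artinSchreier p f)]
  have : (artinSchreier p f).evalEval x y = 0 := by
    simp [artinSchreier, evalEval, ← h]
  rw [evalEval_add, evalEval_mul, this, zero_mul, add_zero]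

/-- A bivariate polynomial of degree `< p` in the outer variable vanishing on the whole curve
`y ^ p - y = f x` has all its coefficients vanishing at the abscissas. -/
theorem eval_coeff_eq_zero_of_forall_curve [Fact p.Prime] [CharP K p] {f : K[X]} {x y : K}
    (h : y ^ p - y = f.eval x) {P : K[X][X]} (hdeg : P.natDegree < p)
    (hP : ∀ z : K, z ^ p - z = f.eval x → P.evalEval x z = 0) (v : ℕ) :
    (P.coeff v).eval x = 0 := by
  have hz : P.map (evalRingHom x) = 0 := by
    refine eq_zero_of_natDegree_lt_card_of_eval_eq_zero (P.map (evalRingHom x))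
      (f := fun c : ZMod p => y + ZMod.castHom dvd_rfl K c) ?_ ?_ ?_
    · intro a b hab
      exact (ZMod.castHom dvd_rfl K).injective (by simpa using hab)
    · intro c
      have := hP (y + ZMod.castHom dvd_rfl K c) (by
        rw [add_pow_char, ← map_pow, ZMod.pow_card, ← h]; ring)
      rw [← map_evalRingHom_eval] at this
      exact this
    · rw [ZMod.card]
      exact (natDegree_map_le).trans_lt hdeg
  have := congrArg (fun P => P.coeff v) hz
  simpa using this

/-- The monomial-like products from which the auxiliary function of Stepanov's method is built. -/
noncomputable def auxTerm (g : K[X]) (n j b : ℕ) : K[X][X] := C (X ^ n) * X ^ j * (X + C g) ^ b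

theorem evalEval_auxTerm (g : K[X]) (n j b : ℕ) (x y : K) :
    (auxTerm g n j b).evalEval x y = x ^ n * y ^ j * (y + g.eval x) ^ b := by
  simp [auxTerm, evalEval]

theorem X_add_C_mem_wtLE {g : K[X]} (hg : d ≤ p * g.natDegree) :
    X + C g ∈ wtLE K p d (p * g.natDegree) :=
  Submodule.add_mem _ (wtLE_mono hg X_mem_wtLE) (C_mem_wtLE le_rfl)

theorem auxTerm_mem_wtLE {g : K[X]} (hg : d ≤ p * g.natDegree) (n j b : ℕ) :
    auxTerm g n j b ∈ wtLE K p d (p * n + j * d + b * (p * g.natDegree)) := by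
  refine mul_mem_wtLE (mul_mem_wtLE (C_mem_wtLE ?_) (pow_mem_wtLE X_mem_wtLE j))
    (pow_mem_wtLE (X_add_C_mem_wtLE hg) b)
  rw [natDegree_X_pow]

theorem auxTerm_modByMonic_coeff_ne_zero {m : K[X][X]} (hm : m.Monic)
    (hmw : m ∈ wtLE K p d (d * m.natDegree)) {g : K[X]} (hg : d < p * g.natDegree)
    {n j b : ℕ} (hj : j < m.natDegree) :
    ((auxTerm g n j b %ₘ m).coeff j).coeff (n + b * g.natDegree) ≠ 0 := by
  have hg0 : g ≠ 0 := by rintro rfl; simp at hg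
  have hlead : ((C (X ^ n * g ^ b) * X ^ j : K[X][X]) %ₘ m).coeff j = X ^ n * g ^ b := by
    rw [(modByMonic_eq_self_iff hm).2]
    · rw [coeff_C_mul_X_pow, if_pos rfl]
    · refine (degree_C_mul_X_pow_le _ _).trans_lt ?_
      rw [degree_eq_natDegree hm.ne_zero]
      exact_mod_cast hj
  have htop : (X ^ n * g ^ b).coeff (n + b * g.natDegree) = g.leadingCoeff ^ b := by
    rw [add_comm, coeff_X_pow_mul, ← natDegree_pow, coeff_natDegree, leadingCoeff_pow]
  have hsplit : auxTerm g n j b = C (X ^ n * g ^ b) * X ^ j +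
      C (X ^ n) * X ^ j * ((X + C g) ^ b - C g ^ b) := by
    rw [auxTerm, C_mul, (C_pow : C (g ^ b) = C g ^ b)]; ring
  have hrest : ((C (X ^ n) * X ^ j * ((X + C g) ^ b - C g ^ b) %ₘ m).coeff j).coeff
      (n + b * g.natDegree) = 0 := by
    rcases b with _ | b
    · simp
    have hw : (X + C g) ^ (b + 1) - C g ^ (b + 1) ∈ wtLE K p d (b * (p * g.natDegree) + d) := by
      rw [← (Commute.all (X + C g) (C g)).geom_sum₂_mul, add_sub_cancel_right]
      refine mul_mem_wtLE (Submodule.sum_mem _ fun k hk => ?_) X_mem_wtLE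
      rw [Finset.mem_range] at hk
      refine wtLE_mono ?_ (mul_mem_wtLE (pow_mem_wtLE (X_add_C_mem_wtLE hg.le) k)
        (pow_mem_wtLE (C_mem_wtLE le_rfl) (b + 1 - 1 - k)))
      rw [← add_mul]
      exact Nat.mul_le_mul_right _ (by omega)
    refine coeff_coeff_eq_zero_of_mem_wtLE (modByMonic_mem_wtLE hm hmw
      (mul_mem_wtLE (mul_mem_wtLE (C_mem_wtLE (W := p * n) ?_) (pow_mem_wtLE X_mem_wtLE j)) hw)) ?_
    · rw [natDegree_X_pow]
    · nlinarith
  rw [hsplit, add_modByMonic, coeff_add, coeff_add, hrest, hlead, htop, add_zero]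
  exact pow_ne_zero _ (leadingCoeff_ne_zero.2 hg0)

theorem weight_injective {Q : ℕ} (hpd : Nat.Coprime p d) {i j a b i' j' a' b' : ℕ}
    (hj : j < p) (hb : b < p) (hj' : j' < p) (hb' : b' < p)
    (hlt : p * i + d * j < Q) (hlt' : p * i' + d * j' < Q)
    (h : p * i + d * j + Q * (p * a + d * b) = p * i' + d * j' + Q * (p * a' + d * b')) :
    i = i' ∧ j = j' ∧ a = a' ∧ b = b' := by
  have hQ : 0 < Q := by omega
  have key : ∀ {i j i' j' : ℕ}, j < p → j' < p → p * i + d * j = p * i' + d * j' →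
      i = i' ∧ j = j' := by
    intro i j i' j' hj hj' h
    have hmod : d * j ≡ d * j' [MOD p] := by
      have := congrArg (· % p) h
      simpa [Nat.ModEq, Nat.add_mod, Nat.mul_mod] using this
    have hjj : j = j' := by
      have := Nat.ModEq.cancel_left_of_coprime hpd hmod
      rwa [Nat.ModEq, Nat.mod_eq_of_lt hj, Nat.mod_eq_of_lt hj'] at this
    subst hjj
    exact ⟨Nat.eq_of_mul_eq_mul_left (by omega) (Nat.add_right_cancel h), rfl⟩
  have h1 : p * i + d * j = p * i' + d * j' := by
    have := congrArg (· % Q) h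
    simpa [Nat.add_mul_mod_self_left, Nat.mod_eq_of_lt hlt, Nat.mod_eq_of_lt hlt'] using this
  have h2 : p * a + d * b = p * a' + d * b' := by
    rw [h1] at h
    exact Nat.eq_of_mul_eq_mul_left hQ (Nat.add_left_cancel h)
  obtain ⟨r1, r2⟩ := key hj hj' h1
  obtain ⟨r3, r4⟩ := key hb hb' h2
  exact ⟨r1, r2, r3, r4⟩
theorem exists_ne_zero_sum_smul_eq_zero {ι : Type*} [Fintype ι] {p U : ℕ} (E : ι → K[X][X])
    (hv : ∀ k, (E k).natDegree < p) (hu : ∀ k v, ((E k).coeff v).natDegree ≤ U)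
    (hcard : p * (U + 1) < Fintype.card ι) :
    ∃ c : ι → K, c ≠ 0 ∧ ∑ k, c k • E k = 0 := by
  let L : (ι → K) →ₗ[K] (Fin p × Fin (U + 1) → K) :=
    { toFun := fun c vu => ((∑ k, c k • E k).coeff vu.1).coeff vu.2
      map_add' := by
        intro a b; ext vu; simp [add_smul, Finset.sum_add_distrib]
      map_smul' := by
        intro a b; ext vu; simp [mul_smul, Finset.mul_sum] }
  have hker : LinearMap.ker L ≠ ⊥ := by
    apply LinearMap.ker_ne_bot_of_finrank_lt
    simpa using hcard
  obtain ⟨c, hc, hc0⟩ := Submodule.exists_mem_ne_zero_of_ne_bot hker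
  refine ⟨c, hc0, ?_⟩
  ext v u
  rw [coeff_zero, coeff_zero]
  by_cases hvu : v < p ∧ u < U + 1
  · exact congrFun (LinearMap.mem_ker.1 hc) (⟨v, hvu.1⟩, ⟨u, hvu.2⟩)
  · rw [finsetSum_coeff, finsetSum_coeff]
    refine Finset.sum_eq_zero fun k _ => ?_
    rw [coeff_smul, coeff_smul]
    by_cases h : v < p
    · rw [coeff_eq_zero_of_natDegree_lt (n := u) (lt_of_le_of_lt (hu k v) (by omega)), smul_zero]
    · rw [coeff_eq_zero_of_natDegree_lt (n := v) (lt_of_lt_of_le (hv k) (by omega)), coeff_zero,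
        smul_zero]

set_option maxHeartbeats 1000000 in
/-- The auxiliary polynomial of Stepanov's method for the curve `y ^ p - y = f x` over a field with
`p ^ (2 * (n + 1))` elements. -/
theorem exists_stepanov_polynomial [Fintype K] [Fact p.Prime] [CharP K p] {f : K[X]}
    (hf : 0 < f.natDegree) (hpf : Nat.Coprime p f.natDegree) {n I A : ℕ}
    (hcardK : Fintype.card K = p ^ (n + 1) * p ^ (n + 1))
    (hI : p * (I + f.natDegree) ≤ p ^ (n + 1)) (hA0 : 0 < A)
    (hIA : p ^ (n + 1) * (I + f.natDegree - 1) + (A + f.natDegree) < I * A * p) :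
    ∃ h : K[X], h ≠ 0 ∧
      h.natDegree ≤ (I + f.natDegree - 1) + p ^ (n + 1) * (A + f.natDegree - 1) ∧
      ∀ x y : K, y ^ p - y = f.eval x → h.eval x = 0 := by
  classical
  have hp := (Fact.out : p.Prime).two_le
  set d := f.natDegree with hd
  set Q := p ^ (n + 1) with hQ
  set m := artinSchreier p f with hmdef
  have hm : m.Monic := artinSchreier_monic hp f
  have hmdeg : m.natDegree = p := artinSchreier_natDegree hp f
  have hmw : m ∈ wtLE K p d (d * m.natDegree) := artinSchreier_mem_wtLE hp f
  set g := frobSum p f (n + 1) with hg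
  have hgdeg : p * g.natDegree = Q * d := by
    rw [hg, frobSum_natDegree hp hf, hQ, pow_succ]; ring
  have hQ2 : 2 ≤ Q := hp.trans (Nat.le_self_pow (by omega) p)
  have hgd : d < p * g.natDegree := by rw [hgdeg]; nlinarith
  have hQp : Q = p ^ (n + 1) := rfl
  clear_value Q g
  have hm1 : m ≠ 1 := by
    intro h
    rw [h, natDegree_one] at hmdeg
    omega
  -- bounds on the weights of the two halves of the exponents
  have hbd : ∀ {N i j : ℕ}, i < N → j < p → p * i + j * d ≤ p * (N + d - 1) := by
    intro N i j hi hj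
    obtain ⟨N, rfl⟩ : ∃ N', N = N' + 1 := ⟨N - 1, by omega⟩
    have : N + 1 + d - 1 = N + d := by omega
    rw [this]
    nlinarith [Nat.mul_le_mul_left p (Nat.lt_succ_iff.1 hi), Nat.mul_le_mul_right d hj.le]
  let ι := (Fin I × Fin p) × (Fin A × Fin p)
  let E : ι → K[X][X] := fun k => auxTerm g (k.1.1 * Q + k.2.1) k.2.2 k.1.2 %ₘ m
  let H : ι → K[X][X] := fun k => auxTerm g (k.1.1 + k.2.1 * Q) k.1.2 k.2.2 %ₘ m
  have hEw : ∀ k, E k ∈ wtLE K p d (p * (Q * (I + d - 1) + (A + d - 1))) := by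
    rintro ⟨⟨i, j⟩, ⟨a, b⟩⟩
    refine modByMonic_mem_wtLE hm hmw (wtLE_mono ?_ (auxTerm_mem_wtLE hgd.le _ _ _))
    rw [hgdeg]
    have h1 := Nat.mul_le_mul_left Q (hbd i.2 j.2)
    have h2 := hbd a.2 b.2
    simp only
    nlinarith
  have hHw : ∀ k : ι, H k ∈ wtLE K p d
      (p * k.1.1 + d * k.1.2 + Q * (p * k.2.1 + d * k.2.2)) := by
    rintro ⟨⟨i, j⟩, ⟨a, b⟩⟩
    refine modByMonic_mem_wtLE hm hmw (wtLE_mono ?_ (auxTerm_mem_wtLE hgd.le _ _ _))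
    rw [hgdeg]
    simp only
    nlinarith
  have hdegu : ∀ {P : K[X][X]} {W : ℕ}, P ∈ wtLE K p d (p * W) →
      ∀ v, (P.coeff v).natDegree ≤ W := by
    intro P W hP v
    rw [natDegree_le_iff_coeff_eq_zero]
    intro u hu
    refine coeff_coeff_eq_zero_of_mem_wtLE hP ?_
    nlinarith
  obtain ⟨c, hc0, hc⟩ := exists_ne_zero_sum_smul_eq_zero (p := p) E
    (fun k => hmdeg ▸ natDegree_modByMonic_lt _ hm hm1) (fun k v => hdegu (hEw k) v) (by
      have : Fintype.card ι = I * p * (A * p) := by simp [ι]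
      rw [this]
      have h2 : Q * (I + d - 1) + (A + d - 1) + 1 = Q * (I + d - 1) + (A + d) := by omega
      rw [h2]
      nlinarith)
  -- take `Q`-th roots of the coefficients
  have hsurj : Function.Surjective (fun z : K => z ^ Q) := by
    rw [← Finite.injective_iff_surjective, hQp]
    exact iterateFrobenius_inj K p (n + 1)
  choose s hs using fun k => hsurj (c k)
  simp only at hs
  have hs0 : ∃ k, s k ≠ 0 := by
    by_contra! h
    refine hc0 (funext fun k => ?_)
    rw [← hs, h, zero_pow (by omega), Pi.zero_apply]
  obtain ⟨k₀, hk₀, hmax⟩ := Finset.exists_max_image (Finset.univ.filter fun k => s k ≠ 0)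
    (fun k : ι => p * (k.1.1 : ℕ) + d * k.1.2 + Q * (p * k.2.1 + d * k.2.2))
    (by obtain ⟨k, hk⟩ := hs0; exact ⟨k, by simpa using hk⟩)
  set P : K[X][X] := ∑ k, s k • H k with hPdef
  have hPne : (P.coeff k₀.1.2) ≠ 0 := by
    intro h0
    have h1 : (P.coeff k₀.1.2).coeff
        ((k₀.1.1 + k₀.2.1 * Q) + k₀.2.2 * g.natDegree) = 0 := by rw [h0, coeff_zero]
    rw [hPdef, finsetSum_coeff, finsetSum_coeff, Finset.sum_eq_single k₀] at h1
    · rw [coeff_smul, coeff_smul, smul_eq_mul] at h1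
      exact mul_ne_zero (by simpa using hk₀)
        (auxTerm_modByMonic_coeff_ne_zero hm hmw hgd (by rw [hmdeg]; exact k₀.1.2.2)) h1
    · intro k _ hk
      rw [coeff_smul, coeff_smul]
      by_cases hsk : s k = 0
      · rw [hsk, zero_smul]
      have hle := hmax k (by simpa using hsk)
      have hne : p * (k.1.1 : ℕ) + d * k.1.2 + Q * (p * k.2.1 + d * k.2.2) ≠
          p * (k₀.1.1 : ℕ) + d * k₀.1.2 + Q * (p * k₀.2.1 + d * k₀.2.2) := by
        intro heq
        have hlt : ∀ k : ι, p * (k.1.1 : ℕ) + d * k.1.2 < Q := fun k => by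
          refine lt_of_lt_of_le ?_ hI
          have h1 := k.1.1.2
          have h2 := k.1.2.2
          nlinarith [Nat.mul_le_mul_left d h2.le]
        obtain ⟨r1, r2, r3, r4⟩ := weight_injective hpf k.1.2.2 k.2.2.2 k₀.1.2.2 k₀.2.2.2
          (hlt k) (hlt k₀) heq
        exact hk (Prod.ext (Prod.ext (Fin.ext r1) (Fin.ext r2))
          (Prod.ext (Fin.ext r3) (Fin.ext r4)))
      rw [coeff_coeff_eq_zero_of_mem_wtLE (hHw k), smul_zero]
      refine lt_of_lt_of_le (lt_of_le_of_ne hle hne) ?_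
      rw [mul_add p (_ + _), mul_left_comm p, hgdeg]
      apply le_of_eq
      ring
    · simp
  refine ⟨P.coeff k₀.1.2, hPne, hdegu (Submodule.sum_mem _ fun k _ => Submodule.smul_mem _ _
    (wtLE_mono ?_ (hHw k))) _, ?_⟩
  · have h1 := hbd k.1.1.2 k.1.2.2
    have h2 := Nat.mul_le_mul_left Q (hbd k.2.1.2 k.2.2.2)
    nlinarith
  · intro x y hxy
    refine eval_coeff_eq_zero_of_forall_curve hxy ?_ ?_ _
    · rw [← hmdeg]
      refine lt_of_le_of_lt (natDegree_sum_le_of_forall_le (n := m.natDegree - 1) _ _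
        fun k _ => ?_) (by omega)
      refine (natDegree_smul_le _ _).trans ?_
      have := natDegree_modByMonic_lt (auxTerm g (k.1.1 + k.2.1 * Q) k.1.2 k.2.2) hm hm1
      exact Nat.le_sub_one_of_lt this
    · intro z hz
      have hzQ : z ^ Q = z + g.eval x := by
        rw [hQp, hg]; exact pow_pow_eq_add_eval_frobSum f hz (n + 1)
      have hcd : ∀ w : K, w ^ (Q * Q) = w := fun w => by
        rw [← hcardK]; exact FiniteField.pow_card w
      have hroot : (P.evalEval x z) ^ Q = 0 := by
        have h1 : P.evalEval x z = ∑ k : ι, s k * (x ^ (k.1.1 + k.2.1 * Q : ℕ) * z ^ (k.1.2 : ℕ) *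
            (z + g.eval x) ^ (k.2.2 : ℕ)) := by
          rw [hPdef, evalEval_finsetSum]
          refine Finset.sum_congr rfl fun k _ => ?_
          rw [evalEval_smul, smul_eq_mul, evalEval_modByMonic_artinSchreier f hz, evalEval_auxTerm]
        have h2 : (∑ k, c k • E k).evalEval x z = ∑ k : ι, c k * (x ^ (k.1.1 * Q + k.2.1 : ℕ) *
            z ^ (k.2.2 : ℕ) * (z + g.eval x) ^ (k.1.2 : ℕ)) := by
          rw [evalEval_finsetSum]
          refine Finset.sum_congr rfl fun k _ => ?_
          rw [evalEval_smul, smul_eq_mul, evalEval_modByMonic_artinSchreier f hz, evalEval_auxTerm]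
        rw [hc, evalEval_zero] at h2
        rw [h1, h2, hQp, sum_pow_char_pow, ← hQp]
        refine Finset.sum_congr rfl fun k _ => ?_
        rw [← hs k, ← hzQ]
        simp only [mul_pow, ← pow_mul]
        have e1 : x ^ ((k.1.1 + k.2.1 * Q) * Q : ℕ) = x ^ (k.1.1 * Q + k.2.1 : ℕ) := by
          rw [add_mul, pow_add, pow_add, mul_assoc, mul_comm (k.2.1 : ℕ), pow_mul x (Q * Q), hcd]
        have e2 : z ^ (Q * k.2.2 * Q : ℕ) = z ^ (k.2.2 : ℕ) := by
          rw [mul_right_comm, pow_mul, hcd]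
        rw [e1, e2, mul_comm (k.1.2 : ℕ) Q]
        ring
      exact pow_eq_zero_iff (by omega) |>.1 hroot
theorem card_artinSchreier_le [Fintype K] [DecidableEq K] [Fact p.Prime] [CharP K p] {f : K[X]}
    (hf : 0 < f.natDegree) (hpf : Nat.Coprime p f.natDegree) {n : ℕ}
    (hcardK : Fintype.card K = p ^ (n + 1) * p ^ (n + 1))
    (hn : (f.natDegree + 1) ^ 2 ≤ p ^ n) :
    (Finset.univ.filter fun x : K => ∃ y : K, y ^ p - y = f.eval x).card ≤
      p ^ n + p ^ (n + 1) * (p ^ n + 2 * f.natDegree) := by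
  have hp := (Fact.out : p.Prime).two_le
  set d := f.natDegree with hd
  set R := p ^ n with hR
  have hQ : p ^ (n + 1) = p * R := by rw [pow_succ, mul_comm]
  have hdR : d < R := by nlinarith
  obtain ⟨I, hI⟩ := Nat.exists_eq_add_of_lt hdR
  obtain ⟨h, hne, hdeg, hroot⟩ := exists_stepanov_polynomial (f := f) (I := R - d)
    (A := R + d + 1) hf hpf hcardK (by rw [hQ, ← hd, Nat.sub_add_cancel hdR.le]) (by omega) (by
      rw [hQ, ← hd, Nat.sub_add_cancel hdR.le]
      have e1 : R - d = I + 1 := by omega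
      have e2 : R - 1 = d + I := by omega
      rw [e1, e2, hI]
      rw [hI] at hn
      nlinarith [mul_le_mul hp hn (Nat.zero_le _) (Nat.zero_le _), Nat.mul_le_mul_right d hp,
        Nat.mul_le_mul_right I hp])
  rw [← hd] at hdeg
  calc _ ≤ h.roots.toFinset.card := by
        refine Finset.card_le_card fun x hx => ?_
        obtain ⟨y, hy⟩ := (Finset.mem_filter.1 hx).2
        rw [Multiset.mem_toFinset, mem_roots hne]
        exact hroot x y hy
    _ ≤ h.roots.card := Multiset.toFinset_card_le _
    _ ≤ h.natDegree := card_roots' h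
    _ ≤ _ := hdeg
    _ ≤ _ := by
        have e1 : R - d + d - 1 ≤ R := by omega
        have e2 : R + d + 1 + d - 1 = R + 2 * d := by omega
        rw [e2]
        omega

/-- Square-root cancellation, up to a constant depending only on `p` and the degree, for additive
character sums over large finite fields of square cardinality. -/
theorem norm_sum_addChar_le_of_stepanov [Fintype K] [Fact p.Prime] [CharP K p] {f : K[X]}
    (hf : 0 < f.natDegree) (hpf : Nat.Coprime p f.natDegree) {n : ℕ}
    (hcardK : Fintype.card K = p ^ (n + 1) * p ^ (n + 1))
    (hn : (f.natDegree + 1) ^ 2 ≤ p ^ n) (χ : AddChar K ℂ) (hχ : χ ≠ 1)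
    (hfrob : ∀ y, χ (y ^ p) = χ y) :
    ‖∑ x : K, χ (f.eval x)‖ ≤ (2 * f.natDegree * p + 1) * (p : ℝ) ^ (n + 1) := by
  classical
  have hp := (Fact.out : p.Prime).two_le
  -- the subgroup `V` of the values of `y ^ p - y`
  let φ : K →+ K := (frobenius K p : K →+ K) - AddMonoidHom.id K
  have hφ : ∀ y, φ y = y ^ p - y := fun y => by simp [φ, frobenius_def]
  let V : Finset K := Finset.univ.image φ
  have hVcard : Fintype.card K ≤ p * V.card := by
    have := Finset.card_le_mul_card_image (s := (Finset.univ : Finset K)) (f := φ) p (by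
      intro b hb
      have hdeg : (X ^ p - X - C b : K[X]).natDegree = p := by
        rw [sub_sub, natDegree_sub_eq_left_of_natDegree_lt] <;> simp; omega
      have hne : (X ^ p - X - C b : K[X]) ≠ 0 := by
        intro h; rw [h] at hdeg; simp at hdeg; omega
      calc _ ≤ (X ^ p - X - C b : K[X]).roots.toFinset.card := by
            refine Finset.card_le_card fun y hy => ?_
            rw [Finset.mem_filter, hφ] at hy
            rw [Multiset.mem_toFinset, mem_roots hne]
            simp [hy.2]
        _ ≤ _ := Multiset.toFinset_card_le _
        _ ≤ _ := (card_roots' _).trans hdeg.le)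
    simpa [V, mul_comm] using this
  have hVχ : ∀ v ∈ V, χ v = 1 := by
    intro v hv
    obtain ⟨y, -, rfl⟩ := Finset.mem_image.1 hv
    rw [hφ, AddChar.map_sub_eq_div, hfrob, div_self (χ.val_isUnit y).ne_zero]
  have hVne : 0 < V.card := Finset.card_pos.2 ⟨φ 0, Finset.mem_image_of_mem _ (Finset.mem_univ _)⟩
  let N : K → ℕ := fun u => (Finset.univ.filter fun x : K => f.eval x - u ∈ V).card
  set M : ℕ := p ^ n + p ^ (n + 1) * (p ^ n + 2 * f.natDegree) with hM
  have hNM : ∀ u, N u ≤ M := by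
    intro u
    have h1 := card_artinSchreier_le (K := K) (f := f - C u) (p := p) (n := n)
      (by rwa [natDegree_sub_C]) (by rwa [natDegree_sub_C]) hcardK (by rwa [natDegree_sub_C])
    rw [natDegree_sub_C] at h1
    convert h1 using 3 with x
    simp [V, hφ]
  have hcount : ∀ F : K → ℂ, ∑ u : K, F u * N u = ∑ x : K, ∑ v ∈ V, F (f.eval x - v) := by
    intro F
    have : ∀ x : K, ∑ v ∈ V, F (f.eval x - v) =
        ∑ u : K, if f.eval x - u ∈ V then F u else 0 := by
      intro x
      rw [← Finset.sum_filter]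
      refine Finset.sum_bij' (fun v _ => f.eval x - v) (fun u _ => f.eval x - u) ?_ ?_ ?_ ?_ ?_ <;>
        simp
    simp_rw [this]
    rw [Finset.sum_comm]
    refine Finset.sum_congr rfl fun u _ => ?_
    rw [← Finset.sum_filter, Finset.sum_const, nsmul_eq_mul, mul_comm]
  have hS : (V.card : ℂ) * ∑ x : K, χ (f.eval x) = ∑ u : K, χ u * ((N u : ℂ) - M) := by
    have h0 : ∑ u : K, χ u = 0 := AddChar.sum_eq_zero_of_ne_one hχ
    simp_rw [mul_sub, Finset.sum_sub_distrib, ← Finset.sum_mul, h0, zero_mul, sub_zero]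
    rw [hcount, Finset.mul_sum]
    refine Finset.sum_congr rfl fun x _ => ?_
    rw [Finset.sum_congr rfl (fun v hv => by
      rw [AddChar.map_sub_eq_div, hVχ v hv, div_one]), Finset.sum_const, nsmul_eq_mul]
  have htot : ∑ u : K, (N u : ℝ) = Fintype.card K * V.card := by
    have := hcount (fun _ => 1)
    simp only [one_mul, Finset.sum_const, nsmul_eq_mul, mul_one, Finset.card_univ] at this
    exact_mod_cast this
  have hbound : (V.card : ℝ) * ‖∑ x : K, χ (f.eval x)‖ ≤
      Fintype.card K * M - Fintype.card K * V.card := by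
    calc (V.card : ℝ) * ‖∑ x : K, χ (f.eval x)‖
        = ‖∑ u : K, χ u * ((N u : ℂ) - M)‖ := by rw [← hS, norm_mul, Complex.norm_natCast]
      _ ≤ ∑ u : K, ((M : ℝ) - N u) := by
          refine norm_sum_le_of_le _ fun u _ => ?_
          rw [norm_mul, AddChar.norm_apply, one_mul, norm_sub_rev]
          have : (M : ℂ) - N u = ((M - N u : ℕ) : ℂ) := by
            rw [Nat.cast_sub (hNM u)]
          rw [this, Complex.norm_natCast, Nat.cast_sub (hNM u)]
      _ = _ := by
          rw [Finset.sum_sub_distrib, htot, Finset.sum_const, nsmul_eq_mul, Finset.card_univ]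
  have hV' : (Fintype.card K : ℝ) ≤ p * V.card := by exact_mod_cast hVcard
  have hVpos : (0 : ℝ) < V.card := by exact_mod_cast hVne
  have hfin : ‖∑ x : K, χ (f.eval x)‖ ≤ p * M - Fintype.card K := by
    refine le_of_mul_le_mul_left (hbound.trans ?_) hVpos
    have : (0 : ℝ) ≤ M := by positivity
    nlinarith
  refine hfin.trans (le_of_eq ?_)
  rw [hcardK, hM]
  push_cast
  ring
end Stepanov

section Newton
variable {R : Type*} [CommRing R]

theorem Multiset.mul_esymm_eq_neg_sum (s : Multiset R) (k : ℕ) :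
    (k : R) * ((-1) ^ k * s.esymm k) =
      -∑ i ∈ Finset.range k, (-1) ^ i * s.esymm i * (s.map (· ^ (k - i))).sum := by
  obtain ⟨n, x, rfl⟩ : ∃ (n : ℕ) (x : Fin n → R), Finset.univ.val.map x = s :=
    ⟨s.toList.length, s.toList.get, by
      rw [Fin.univ_val_map, List.ofFn_get, Multiset.coe_toList]⟩
  have h := congrArg (MvPolynomial.aeval x) (MvPolynomial.mul_esymm_eq_sum (Fin n) R k)
  have hfilter : (Finset.HasAntidiagonal.antidiagonal k).filter (fun a => a.1 < k) =
      (Finset.range k).image fun i => (i, k - i) := by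
    ext ⟨a, b⟩
    simp only [Finset.mem_filter, Finset.HasAntidiagonal.mem_antidiagonal, Finset.mem_image,
      Finset.mem_range, Prod.mk.injEq]
    constructor
    · rintro ⟨h1, h2⟩
      exact ⟨a, h2, rfl, by omega⟩
    · rintro ⟨i, h1, rfl, rfl⟩
      exact ⟨by omega, h1⟩
  rw [hfilter, Finset.sum_image (by intro a _ b _ hab; simpa using (Prod.ext_iff.1 hab).1)] at h
  simp only [map_mul, map_natCast, map_pow, map_neg, map_one, map_sum,
    MvPolynomial.aeval_esymm_eq_multiset_esymm, MvPolynomial.psum, MvPolynomial.aeval_X] at h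
  simp only [Multiset.map_map, Function.comp_def]
  have hs : (-1 : R) ^ k * (-1) ^ k = 1 := by rw [← mul_pow]; simp
  rw [mul_left_comm, h, ← mul_assoc, pow_succ, ← mul_assoc, hs, one_mul, neg_one_mul]
  rfl

/-- The power sums are determined by Newton's recursion. -/
theorem eq_of_newton_recursion {a P Q : ℕ → R} (ha : a 0 = 1)
    (hP : ∀ k : ℕ, (k : R) * a k = -∑ i ∈ Finset.range k, a i * P (k - i))
    (hQ : ∀ k : ℕ, (k : R) * a k = -∑ i ∈ Finset.range k, a i * Q (k - i)) {k : ℕ} (hk : 0 < k) :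
    P k = Q k := by
  induction k using Nat.strong_induction_on with
  | _ k ih =>
    have h := (hP k).symm.trans (hQ k)
    obtain ⟨k, rfl⟩ := Nat.exists_eq_succ_of_ne_zero hk.ne'
    rw [Finset.sum_range_succ', Finset.sum_range_succ' _ k, Finset.sum_congr rfl (fun i hi => by
      rw [ih (k.succ - (i + 1)) (by omega) (by have := Finset.mem_range.1 hi; omega)])] at h
    simpa [ha] using h

/-- Changing the `d`-th elementary symmetric function, and none of the previous ones, changes
the `d`-th power sum, and none of the previous ones. -/
theorem sum_pow_of_esymm_eq {s t : Multiset R} {d : ℕ}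
    (h : ∀ i < d, s.esymm i = t.esymm i) :
    (∀ j < d, 0 < j → (s.map (· ^ j)).sum = (t.map (· ^ j)).sum) ∧
      (0 < d → (s.map (· ^ d)).sum = (t.map (· ^ d)).sum -
        d * ((-1) ^ d * s.esymm d - (-1) ^ d * t.esymm d)) := by
  have esymm_zero : ∀ u : Multiset R, u.esymm 0 = 1 := fun u => by simp [Multiset.esymm]
  have key : ∀ j ≤ d, 0 < j → (s.map (· ^ j)).sum = (t.map (· ^ j)).sum -
        j * ((-1) ^ j * s.esymm j - (-1) ^ j * t.esymm j) := by
    intro j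
    induction j using Nat.strong_induction_on with
    | _ j ih =>
      intro hjd hj
      have h1 := s.mul_esymm_eq_neg_sum j
      have h2 := t.mul_esymm_eq_neg_sum j
      obtain ⟨j, rfl⟩ := Nat.exists_eq_succ_of_ne_zero hj.ne'
      rw [Finset.sum_range_succ'] at h1 h2
      rw [Finset.sum_congr rfl (fun i hi => by
        have := Finset.mem_range.1 hi
        rw [ih (j.succ - (i + 1)) (by omega) (by omega) (by omega), h (i + 1) (by omega),
          h (j.succ - (i + 1)) (by omega), sub_self, mul_zero, sub_zero])] at h1
      simp only [pow_zero, one_mul, esymm_zero, Nat.sub_zero] at h1 h2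
      linear_combination h1 - h2
  refine ⟨fun j hj hj0 => ?_, key d le_rfl⟩
  rw [key j hj.le hj0, h j hj, sub_self, mul_zero, sub_zero]
end Newton

section RootChar
variable {F : Type*} [Field F]

/-- The sum of the values of `f` at the roots of `G` in the algebraic closure. -/
noncomputable def rootSum (f G : F[X]) : AlgebraicClosure F :=
  ((G.aroots (AlgebraicClosure F)).map fun α => aeval α f).sum

theorem rootSum_mul (f : F[X]) {G H : F[X]} (hG : G ≠ 0) (hH : H ≠ 0) :
    rootSum f (G * H) = rootSum f G + rootSum f H := by
  rw [rootSum, aroots_mul (mul_ne_zero hG hH), Multiset.map_add, Multiset.sum_add, rootSum,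
    rootSum]

theorem rootSum_one (f : F[X]) : rootSum f 1 = 0 := by
  simp [rootSum]

theorem neg_one_pow_mul_esymm_aroots {G : F[X]} (hG : G.Monic) {i : ℕ} (hi : i ≤ G.natDegree) :
    (-1) ^ i * (G.aroots (AlgebraicClosure F)).esymm i =
      algebraMap F (AlgebraicClosure F) (G.coeff (G.natDegree - i)) := by
  have h := coeff_eq_esymm_roots_of_splits
    (IsAlgClosed.splits (G.map (algebraMap F (AlgebraicClosure F))))
    (k := G.natDegree - i) (by simp)
  rw [coeff_map, hG.map, natDegree_map, Nat.sub_sub_self hi, one_mul] at h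
  exact h.symm

theorem rootSum_eq_sum (f G : F[X]) :
    rootSum f G = ∑ j ∈ Finset.range (f.natDegree + 1),
      algebraMap F (AlgebraicClosure F) (f.coeff j) *
        ((G.aroots (AlgebraicClosure F)).map (· ^ j)).sum := by
  simp_rw [rootSum, aeval_eq_sum_range, Algebra.smul_def, ← Multiset.sum_map_mul_left]
  exact Multiset.sum_map_sum_map _ _

theorem natDegree_add_C_mul_X_pow {G : F[X]} {d : ℕ} (hd : 0 < d)
    (hdG : d ≤ G.natDegree) (c : F) :
    (G + C c * X ^ (G.natDegree - d)).natDegree = G.natDegree := by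
  refine natDegree_add_eq_left_of_natDegree_lt (lt_of_le_of_lt (natDegree_C_mul_X_pow_le _ _) ?_)
  omega

theorem monic_add_C_mul_X_pow {G : F[X]} (hG : G.Monic) {d : ℕ} (hd : 0 < d)
    (hdG : d ≤ G.natDegree) (c : F) : (G + C c * X ^ (G.natDegree - d)).Monic := by
  refine hG.add_of_left (degree_lt_degree (lt_of_le_of_lt (natDegree_C_mul_X_pow_le _ _) ?_))
  omega

theorem rootSum_add_C_mul_X_pow (f : F[X]) {G : F[X]} (hG : G.Monic) (hf : 0 < f.natDegree)
    (hfG : f.natDegree ≤ G.natDegree) (c : F) :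
    rootSum f (G + C c * X ^ (G.natDegree - f.natDegree)) =
      rootSum f G - algebraMap F (AlgebraicClosure F) (f.natDegree * c * f.leadingCoeff) := by
  set d := f.natDegree with hd
  set G' := G + C c * X ^ (G.natDegree - d) with hG'
  have hdeg : G'.natDegree = G.natDegree := natDegree_add_C_mul_X_pow hf hfG c
  have hmon : G'.Monic := monic_add_C_mul_X_pow hG hf hfG c
  have hcoeff : ∀ i ≤ d, (-1) ^ i * (G'.aroots (AlgebraicClosure F)).esymm i =
      (-1) ^ i * (G.aroots (AlgebraicClosure F)).esymm i +
        algebraMap F (AlgebraicClosure F) (if i = d then c else 0) := by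
    intro i hi
    rw [neg_one_pow_mul_esymm_aroots hmon (by omega), neg_one_pow_mul_esymm_aroots hG (by omega),
      hdeg, hG', coeff_add, coeff_C_mul_X_pow, map_add]
    congr 3
    exact propext ⟨fun h => by omega, fun h => by omega⟩
  obtain ⟨h1, h2⟩ := sum_pow_of_esymm_eq (s := G'.aroots (AlgebraicClosure F))
    (t := G.aroots (AlgebraicClosure F)) (d := d) (by
      intro i hi
      have h := hcoeff i hi.le
      rw [if_neg hi.ne, map_zero, add_zero] at h
      exact mul_left_cancel₀ (pow_ne_zero _ (neg_ne_zero.2 one_ne_zero)) h)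
  rw [rootSum_eq_sum, rootSum_eq_sum, Finset.sum_range_succ, Finset.sum_range_succ, h2 hf,
    hcoeff d le_rfl, if_pos rfl]
  have hlt : ∀ j ∈ Finset.range f.natDegree,
      algebraMap F (AlgebraicClosure F) (f.coeff j) *
        ((G'.aroots (AlgebraicClosure F)).map (· ^ j)).sum =
      algebraMap F (AlgebraicClosure F) (f.coeff j) *
        ((G.aroots (AlgebraicClosure F)).map (· ^ j)).sum := by
    intro j hj
    rcases Nat.eq_zero_or_pos j with rfl | hj0
    · have hcard : ∀ H : F[X], (H.aroots (AlgebraicClosure F)).card = H.natDegree := fun H => by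
        rw [← (IsAlgClosed.splits (H.map (algebraMap F _))).natDegree_eq_card_roots,
          natDegree_map]
      simp only [pow_zero, Multiset.map_const', hcard, hdeg]
    · rw [h1 j (Finset.mem_range.1 hj) hj0]
  rw [Finset.sum_congr rfl hlt, leadingCoeff, ← hd]
  push_cast
  ring

/-- An `F`-linear retraction of the algebraic closure onto `F`. -/
noncomputable def closureRetraction (F : Type*) [Field F] : AlgebraicClosure F →ₗ[F] F :=
  (LinearMap.exists_leftInverse_of_injective (Algebra.linearMap F (AlgebraicClosure F))
    (LinearMap.ker_eq_bot.2 (algebraMap F (AlgebraicClosure F)).injective)).choose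

theorem closureRetraction_algebraMap (x : F) :
    closureRetraction F (algebraMap F (AlgebraicClosure F) x) = x :=
  LinearMap.congr_fun (LinearMap.exists_leftInverse_of_injective
    (Algebra.linearMap F (AlgebraicClosure F))
    (LinearMap.ker_eq_bot.2 (algebraMap F (AlgebraicClosure F)).injective)).choose_spec x

/-- The completely multiplicative function on monic polynomials attached to the additive
character `ψ` and the polynomial `f`. -/
noncomputable def rootChar (ψ : AddChar F ℂ) (f G : F[X]) : ℂ :=
  ψ (closureRetraction F (rootSum f G))

variable (ψ : AddChar F ℂ)

theorem rootChar_one (f : F[X]) : rootChar ψ f 1 = 1 := by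
  simp [rootChar, rootSum_one]

theorem rootChar_mul (f : F[X]) {G H : F[X]} (hG : G ≠ 0) (hH : H ≠ 0) :
    rootChar ψ f (G * H) = rootChar ψ f G * rootChar ψ f H := by
  rw [rootChar, rootSum_mul f hG hH, map_add, AddChar.map_add_eq_mul, rootChar, rootChar]

theorem rootChar_pow (f : F[X]) {G : F[X]} (hG : G ≠ 0) (n : ℕ) :
    rootChar ψ f (G ^ n) = rootChar ψ f G ^ n := by
  induction n with
  | zero => simp [rootChar_one]
  | succ n ih => rw [pow_succ, rootChar_mul ψ f (pow_ne_zero _ hG) hG, ih, pow_succ]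

variable [Finite F]

theorem finite_monic_natDegree_eq (F : Type*) [Field F] [Finite F] (n : ℕ) :
    {G : F[X] | G.Monic ∧ G.natDegree = n}.Finite := by
  refine Set.Finite.of_injOn (f := fun (G : F[X]) (i : Fin n) => G.coeff i)
    (t := (Set.univ : Set (Fin n → F))) (fun _ _ => Set.mem_univ _) ?_ Set.finite_univ
  rintro G ⟨hG, hGn⟩ H ⟨hH, hHn⟩ h
  ext i
  rcases lt_trichotomy i n with hi | rfl | hi
  · exact congrFun h ⟨i, hi⟩
  · rw [← hGn, hG.coeff_natDegree, hGn, ← hHn, hH.coeff_natDegree]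
  · rw [coeff_eq_zero_of_natDegree_lt (by omega), coeff_eq_zero_of_natDegree_lt (by omega)]

/-- The monic polynomials of degree `n` over a finite field. -/
noncomputable def monicsOfDegree (F : Type*) [Field F] [Finite F] (n : ℕ) : Finset F[X] :=
  (finite_monic_natDegree_eq F n).toFinset

theorem mem_monicsOfDegree {n : ℕ} {G : F[X]} :
    G ∈ monicsOfDegree F n ↔ G.Monic ∧ G.natDegree = n := by
  simp [monicsOfDegree]

/-- The coefficients of the `L`-function attached to `ψ` and `f`. -/
noncomputable def lCoeff (ψ : AddChar F ℂ) (f : F[X]) (n : ℕ) : ℂ :=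
  ∑ G ∈ monicsOfDegree F n, rootChar ψ f G

theorem lCoeff_zero (f : F[X]) : lCoeff ψ f 0 = 1 := by
  have : monicsOfDegree F 0 = {1} := by
    ext G
    rw [mem_monicsOfDegree, Finset.mem_singleton]
    exact ⟨fun h => h.1.natDegree_eq_zero.1 h.2, fun h => by simp [h]⟩
  rw [lCoeff, this, Finset.sum_singleton, rootChar_one]

theorem lCoeff_eq_zero {ψ : AddChar F ℂ} (hψ : ψ ≠ 1) {f : F[X]} (hf : 0 < f.natDegree)
    (hdF : (f.natDegree : F) ≠ 0) {n : ℕ} (hn : f.natDegree ≤ n) : lCoeff ψ f n = 0 := by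
  obtain ⟨y, hy⟩ := (AddChar.ne_one_iff).1 hψ
  have hlc : f.leadingCoeff ≠ 0 := by
    rw [leadingCoeff_ne_zero]; rintro rfl; simp at hf
  set d := f.natDegree with hd
  set c : F := -y / (d * f.leadingCoeff) with hc
  have hcy : -((d : F) * c * f.leadingCoeff) = y := by rw [hc]; field_simp
  have hmem : ∀ (b : F) (G : F[X]), G ∈ monicsOfDegree F n →
      G + C b * X ^ (n - d) ∈ monicsOfDegree F n := by
    intro b G hG
    rw [mem_monicsOfDegree] at hG ⊢
    obtain ⟨hG, rfl⟩ := hG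
    exact ⟨monic_add_C_mul_X_pow hG hf hn b, natDegree_add_C_mul_X_pow hf hn b⟩
  have h : lCoeff ψ f n = ψ y * lCoeff ψ f n := by
    conv_rhs => rw [lCoeff, Finset.mul_sum]
    refine (Finset.sum_bij' (fun G _ => G + C c * X ^ (n - d))
      (fun G _ => G + C (-c) * X ^ (n - d)) (hmem c) (hmem (-c)) (by simp) (by simp) ?_).symm
    intro G hG
    rw [mem_monicsOfDegree] at hG
    obtain ⟨hG, rfl⟩ := hG
    rw [rootChar, rootChar, rootSum_add_C_mul_X_pow f hG hf hn, sub_eq_add_neg, map_add, map_neg,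
      closureRetraction_algebraMap, hcy, AddChar.map_add_eq_mul, mul_comm]
  by_contra h0
  exact hy (mul_right_cancel₀ h0 (by rw [one_mul, ← h]))
end RootChar

section EulerProduct
variable {F : Type*} [Field F] [Finite F]

open Classical in
/-- The monic irreducible polynomials whose degree divides `i`. -/
noncomputable def primesOfDegreeDvd (F : Type*) [Field F] [Finite F] (i : ℕ) : Finset F[X] :=
  (i.divisors.biUnion (monicsOfDegree F)).filter Irreducible

theorem mem_primesOfDegreeDvd {i : ℕ} (hi : i ≠ 0) {P : F[X]} :
    P ∈ primesOfDegreeDvd F i ↔ P.Monic ∧ Irreducible P ∧ P.natDegree ∣ i := by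
  simp only [primesOfDegreeDvd, Finset.mem_filter, Finset.mem_biUnion, Nat.mem_divisors,
    mem_monicsOfDegree]
  constructor
  · rintro ⟨⟨_, h1, h2, rfl⟩, h3⟩
    exact ⟨h2, h3, h1.1⟩
  · rintro ⟨h1, h2, h3⟩
    exact ⟨⟨_, ⟨h3, hi⟩, h1, rfl⟩, h2⟩

open UniqueFactorizationMonoid in
open Classical in
/-- Each monic irreducible polynomial `P` contributes `P.natDegree` for every power of `P`
dividing `G`. -/
theorem sum_natDegree_of_pow_dvd {G : F[X]} (hG : G.Monic) :
    ∑ i ∈ Finset.Icc 1 G.natDegree, ∑ P ∈ primesOfDegreeDvd F i,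
      (if P ^ (i / P.natDegree) ∣ G then P.natDegree else 0) = G.natDegree := by
  have hG0 := hG.ne_zero
  have hmem : ∀ P, P ∈ (normalizedFactors G).toFinset ↔ Irreducible P ∧ P.Monic ∧ P ∣ G := by
    intro P
    rw [Multiset.mem_toFinset, Polynomial.mem_normalizedFactors_iff hG0]
  have h1 : ∀ i ∈ Finset.Icc 1 G.natDegree, ∑ P ∈ primesOfDegreeDvd F i,
      (if P ^ (i / P.natDegree) ∣ G then P.natDegree else 0) =
      ∑ P ∈ (normalizedFactors G).toFinset,
        if P.natDegree ∣ i ∧ P ^ (i / P.natDegree) ∣ G then P.natDegree else 0 := by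
    intro i hi
    have hi0 : i ≠ 0 := by have := (Finset.mem_Icc.1 hi).1; omega
    rw [← Finset.sum_filter, ← Finset.sum_filter]
    refine Finset.sum_congr ?_ fun _ _ => rfl
    ext P
    rw [Finset.mem_filter, Finset.mem_filter, mem_primesOfDegreeDvd hi0, hmem]
    constructor
    · rintro ⟨⟨h1, h2, h3⟩, h4⟩
      refine ⟨⟨h2, h1, (dvd_pow_self P ?_).trans h4⟩, h3, h4⟩
      exact (Nat.div_pos (Nat.le_of_dvd (by omega) h3) h2.natDegree_pos).ne'
    · rintro ⟨⟨h1, h2, -⟩, h3, h4⟩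
      exact ⟨⟨h2, h1, h3⟩, h4⟩
  rw [Finset.sum_congr rfl h1, Finset.sum_comm]
  have h2 : ∀ P ∈ (normalizedFactors G).toFinset,
      ∑ i ∈ Finset.Icc 1 G.natDegree,
        (if P.natDegree ∣ i ∧ P ^ (i / P.natDegree) ∣ G then P.natDegree else 0) =
      (normalizedFactors G).count P • P.natDegree := by
    intro P hP
    obtain ⟨hirr, hmon, -⟩ := (hmem P).1 hP
    have hpow : ∀ j, P ^ j ∣ G ↔ j ≤ (normalizedFactors G).count P := by
      intro j
      rw [pow_dvd_iff_le_emultiplicity, emultiplicity_eq_count_normalizedFactors hirr hG0,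
        hmon.normalize_eq_self, Nat.cast_le]
    have hpos := hirr.natDegree_pos
    rw [← Finset.sum_filter, Finset.sum_const]
    congr 1
    have : (Finset.Icc 1 G.natDegree).filter
        (fun i => P.natDegree ∣ i ∧ P ^ (i / P.natDegree) ∣ G) =
        (Finset.Icc 1 ((normalizedFactors G).count P)).image (P.natDegree * ·) := by
      ext i
      simp only [Finset.mem_filter, Finset.mem_Icc, Finset.mem_image, hpow]
      constructor
      · rintro ⟨⟨h1, h2⟩, ⟨j, rfl⟩, h3⟩
        rw [Nat.mul_div_cancel_left _ hpos] at h3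
        exact ⟨j, ⟨Nat.pos_of_mul_pos_left h1, h3⟩, rfl⟩
      · rintro ⟨j, ⟨h1, h2⟩, rfl⟩
        rw [Nat.mul_div_cancel_left _ hpos]
        refine ⟨⟨Nat.mul_pos hpos h1, ?_⟩, dvd_mul_right _ _, h2⟩
        have := natDegree_le_of_dvd ((hpow j).2 h2) hG0
        rwa [natDegree_pow, mul_comm] at this
    rw [this, Finset.card_image_of_injective _ (fun a b h => Nat.eq_of_mul_eq_mul_left hpos h),
      Nat.card_Icc, Nat.add_sub_cancel]
  rw [Finset.sum_congr rfl h2, ← Finset.sum_multiset_map_count,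
    ← natDegree_multiset_prod_of_monic _ (fun P hP =>
      ((hmem P).1 (Multiset.mem_toFinset.2 hP)).2.1), prod_normalizedFactors_eq hG0,
    hG.normalize_eq_self]

/-- The power sums of the `L`-function attached to `ψ` and `f`, as sums over irreducible
polynomials. -/
noncomputable def lPower (ψ : AddChar F ℂ) (f : F[X]) (i : ℕ) : ℂ :=
  ∑ P ∈ primesOfDegreeDvd F i, P.natDegree * rootChar ψ f P ^ (i / P.natDegree)

open Classical in
theorem sum_rootChar_of_dvd (ψ : AddChar F ℂ) (f : F[X]) {Q : F[X]} (hQ : Q.Monic) {n : ℕ}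
    (hn : Q.natDegree ≤ n) :
    ∑ G ∈ monicsOfDegree F n, (if Q ∣ G then rootChar ψ f G else 0) =
      rootChar ψ f Q * lCoeff ψ f (n - Q.natDegree) := by
  rw [← Finset.sum_filter, lCoeff, Finset.mul_sum]
  symm
  refine Finset.sum_bij (fun H _ => Q * H) ?_ ?_ ?_ ?_
  · intro H hH
    rw [mem_monicsOfDegree] at hH
    rw [Finset.mem_filter, mem_monicsOfDegree, hQ.natDegree_mul hH.1]
    exact ⟨⟨hQ.mul hH.1, by omega⟩, dvd_mul_right _ _⟩
  · intro H _ H' _ h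
    exact mul_left_cancel₀ hQ.ne_zero h
  · intro G hG
    rw [Finset.mem_filter, mem_monicsOfDegree] at hG
    obtain ⟨⟨hG, hGn⟩, H, rfl⟩ := hG
    have hH : H.Monic := hQ.of_mul_monic_left hG
    rw [hQ.natDegree_mul hH] at hGn
    exact ⟨H, mem_monicsOfDegree.2 ⟨hH, by omega⟩, rfl⟩
  · intro H hH
    rw [mem_monicsOfDegree] at hH
    rw [rootChar_mul ψ f hQ.ne_zero hH.1.ne_zero]

theorem mul_lCoeff (ψ : AddChar F ℂ) (f : F[X]) (n : ℕ) :
    (n : ℂ) * lCoeff ψ f n = ∑ i ∈ Finset.range n, lCoeff ψ f i * lPower ψ f (n - i) := by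
  classical
  have h1 : (n : ℂ) * lCoeff ψ f n = ∑ i ∈ Finset.Icc 1 n, lCoeff ψ f (n - i) * lPower ψ f i := by
    calc (n : ℂ) * lCoeff ψ f n
        = ∑ G ∈ monicsOfDegree F n, ∑ i ∈ Finset.Icc 1 n, ∑ P ∈ primesOfDegreeDvd F i,
          P.natDegree * (if P ^ (i / P.natDegree) ∣ G then rootChar ψ f G else 0) := by
          rw [lCoeff, Finset.mul_sum]
          refine Finset.sum_congr rfl fun G hG => ?_
          obtain ⟨hmon, rfl⟩ := mem_monicsOfDegree.1 hG
          conv_lhs => rw [← sum_natDegree_of_pow_dvd hmon]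
          push_cast
          rw [Finset.sum_mul]
          refine Finset.sum_congr rfl fun i _ => ?_
          rw [Finset.sum_mul]
          refine Finset.sum_congr rfl fun P _ => ?_
          split_ifs <;> simp
      _ = _ := by
          rw [Finset.sum_comm]
          refine Finset.sum_congr rfl fun i hi => ?_
          rw [Finset.sum_comm, lPower, Finset.mul_sum]
          refine Finset.sum_congr rfl fun P hP => ?_
          obtain ⟨hi1, hin⟩ := Finset.mem_Icc.1 hi
          obtain ⟨hmon, hirr, hdvd⟩ := (mem_primesOfDegreeDvd (by omega)).1 hP
          have hdeg : (P ^ (i / P.natDegree)).natDegree = i := by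
            rw [natDegree_pow, Nat.div_mul_cancel hdvd]
          rw [← Finset.mul_sum, sum_rootChar_of_dvd ψ f (hmon.pow _) (by rwa [hdeg]), hdeg,
            rootChar_pow ψ f hmon.ne_zero]
          ring
  rw [h1]
  refine Finset.sum_bij' (fun i _ => n - i) (fun i _ => n - i) ?_ ?_ ?_ ?_ ?_ <;>
    intro i hi <;> simp only [Finset.mem_Icc, Finset.mem_range] at hi ⊢
  · omega
  · omega
  · omega
  · omega
  · rw [Nat.sub_sub_self hi.2]
end EulerProduct

section ExtensionSum
variable {F : Type*} [Field F] [Finite F] {E : Type*} [Field E] [Finite E] [Algebra F E]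

open IntermediateField in
theorem algebraMap_trace_adjoin_aeval (f : F[X]) (x : E) :
    algebraMap F (AlgebraicClosure F)
      (Algebra.trace F F⟮x⟯ (aeval (AdjoinSimple.gen F x) f)) = rootSum f (minpoly F x) := by
  classical
  have hx : IsIntegral F x := .of_finite F x
  have hsep : (minpoly F x).Separable :=
    PerfectField.separable_of_irreducible (minpoly.irreducible hx)
  have hval : ((minpoly F x).aroots (AlgebraicClosure F)).toFinset.val =
      (minpoly F x).aroots (AlgebraicClosure F) := by
    rw [Multiset.toFinset_val, Multiset.dedup_eq_self.2 (nodup_roots hsep.map)]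
  rw [trace_eq_sum_embeddings (AlgebraicClosure F), rootSum, ← hval]
  let φ := algHomAdjoinIntegralEquiv F hx (K := AlgebraicClosure F)
  have hφ : ∀ σ : F⟮x⟯ →ₐ[F] AlgebraicClosure F, (φ σ : AlgebraicClosure F) =
      σ (AdjoinSimple.gen F x) := fun σ => by
    rw [← algHomAdjoinIntegralEquiv_symm_apply_gen F hx, Equiv.symm_apply_apply]
  refine Finset.sum_bij (fun σ _ => (φ σ : AlgebraicClosure F)) ?_ ?_ ?_ ?_
  · exact fun σ _ => Multiset.mem_toFinset.2 (φ σ).2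
  · exact fun σ _ τ _ h => φ.injective (Subtype.ext h)
  · intro α hα
    exact ⟨φ.symm ⟨α, Multiset.mem_toFinset.1 hα⟩, Finset.mem_univ _, by
      rw [Equiv.apply_symm_apply]⟩
  · intro σ _
    rw [hφ, aeval_algHom_apply]

open IntermediateField in
theorem addChar_trace_aeval (ψ : AddChar F ℂ) (f : F[X]) (x : E) :
    ψ (Algebra.trace F E (aeval x f)) =
      rootChar ψ f (minpoly F x) ^ (Module.finrank F E / (minpoly F x).natDegree) := by
  have hx : IsIntegral F x := .of_finite F x
  have h1 : aeval x f = algebraMap F⟮x⟯ E (aeval (AdjoinSimple.gen F x) f) := by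
    rw [← aeval_algebraMap_apply, AdjoinSimple.algebraMap_gen]
  have h2 : Module.finrank F E / (minpoly F x).natDegree = Module.finrank F⟮x⟯ E := by
    rw [← Module.finrank_mul_finrank F F⟮x⟯ E, adjoin.finrank hx,
      Nat.mul_div_cancel_left _ (minpoly.natDegree_pos hx)]
  rw [h1, ← Algebra.trace_trace (S := F⟮x⟯), Algebra.trace_algebraMap, map_nsmul,
    AddChar.map_nsmul_eq_pow, h2, rootChar, ← algebraMap_trace_adjoin_aeval,
    closureRetraction_algebraMap]

theorem card_minpoly_eq [Fintype E] [DecidableEq F[X]] {P : F[X]} (hP : P.Monic)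
    (hirr : Irreducible P) (hdvd : P.natDegree ∣ Module.finrank F E) :
    (Finset.univ.filter fun x : E => minpoly F x = P).card = P.natDegree := by
  classical
  have hsplit : (P.map (algebraMap F E)).Splits := by
    refine (FiniteField.isSplittingField_sub E F).splits.of_dvd
      (map_ne_zero (FiniteField.X_pow_card_sub_X_ne_zero _ Fintype.one_lt_card))
      ((map_dvd_map' _).2 ?_)
    rw [Fintype.card_eq_nat_card, Module.natCard_eq_pow_finrank (K := F)]
    exact (hirr.natDegree_dvd_iff_dvd_X_pow_card_pow_sub_X).1 hdvd
  rw [← card_rootSet_eq_natDegree (PerfectField.separable_of_irreducible hirr) hsplit,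
    Fintype.card_subtype]
  congr 1
  ext x
  rw [Finset.mem_filter, Finset.mem_filter, mem_rootSet_of_ne hP.ne_zero]
  refine and_congr_right fun _ => ⟨?_, fun h => (minpoly.eq_of_irreducible_of_monic hirr h hP).symm⟩
  rintro rfl
  exact minpoly.aeval F x

theorem sum_addChar_trace_eq_lPower [Fintype E] (ψ : AddChar F ℂ) (f : F[X]) :
    ∑ x : E, ψ (Algebra.trace F E (aeval x f)) = lPower ψ f (Module.finrank F E) := by
  classical
  simp_rw [addChar_trace_aeval]
  rw [← Finset.sum_fiberwise_of_maps_to (t := primesOfDegreeDvd F (Module.finrank F E))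
    (g := fun x : E => minpoly F x), lPower]
  · refine Finset.sum_congr rfl fun P hP => ?_
    obtain ⟨hmon, hirr, hdvd⟩ := (mem_primesOfDegreeDvd Module.finrank_pos.ne').1 hP
    rw [Finset.sum_congr rfl (fun x hx => by rw [(Finset.mem_filter.1 hx).2]), Finset.sum_const,
      card_minpoly_eq hmon hirr hdvd, nsmul_eq_mul]
  · intro x _
    have hx : IsIntegral F x := .of_finite F x
    exact (mem_primesOfDegreeDvd Module.finrank_pos.ne').2
      ⟨minpoly.monic hx, minpoly.irreducible hx, minpoly.degree_dvd hx⟩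
end ExtensionSum

section PowerSumGrowth

theorem norm_le_of_norm_sum_pow_le {s : Multiset ℂ} {R C₀ : ℝ} (hR : 0 < R) {m₀ : ℕ}
    (h : ∀ m ≥ m₀, ‖(s.map (· ^ m)).sum‖ ≤ C₀ * R ^ m) {β : ℂ} (hβ : β ∈ s) : ‖β‖ ≤ R := by
  classical
  set Q : ℂ[X] := ∏ γ ∈ s.toFinset.erase β, (X - C γ) with hQ
  have hQβ : Q.eval β ≠ 0 := by
    rw [hQ, eval_prod, Finset.prod_ne_zero_iff]
    intro γ hγ
    simpa [sub_eq_zero] using (Finset.ne_of_mem_erase hγ).symm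
  have hsum : ∀ m, (s.map fun γ => Q.eval γ * γ ^ m).sum = s.count β * (Q.eval β * β ^ m) := by
    intro m
    rw [Finset.sum_multiset_map_count, Finset.sum_eq_single_of_mem β (Multiset.mem_toFinset.2 hβ),
      nsmul_eq_mul]
    intro γ hγ hne
    have : Q.eval γ = 0 := by
      rw [hQ, eval_prod]
      exact Finset.prod_eq_zero (Finset.mem_erase.2 ⟨hne, hγ⟩) (by simp)
    simp [this]
  have hexp : ∀ m, (s.map fun γ => Q.eval γ * γ ^ m).sum =
      ∑ j ∈ Finset.range (Q.natDegree + 1), Q.coeff j * (s.map (· ^ (m + j))).sum := by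
    intro m
    simp_rw [eval_eq_sum_range, Finset.sum_mul, ← Multiset.sum_map_mul_left]
    refine (Multiset.sum_map_sum_map s (Finset.range (Q.natDegree + 1)).val).trans ?_
    refine Finset.sum_congr rfl fun j _ => ?_
    congr 1
    refine Multiset.map_congr rfl fun γ _ => ?_
    ring
  set A : ℝ := ∑ j ∈ Finset.range (Q.natDegree + 1), ‖Q.coeff j‖ * (C₀ * R ^ j) with hA
  have hcount : (1 : ℝ) ≤ s.count β := by
    exact_mod_cast Multiset.one_le_count_iff_mem.2 hβ
  have hQpos : 0 < ‖Q.eval β‖ := norm_pos_iff.2 hQβ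
  have hbound : ∀ m ≥ m₀, (‖β‖ / R) ^ m ≤ A / ‖Q.eval β‖ := by
    intro m hm
    rw [div_pow, div_le_div_iff₀ (pow_pos hR m) hQpos]
    calc ‖β‖ ^ m * ‖Q.eval β‖ ≤ s.count β * (‖Q.eval β‖ * ‖β‖ ^ m) := by
          rw [mul_comm]
          exact le_mul_of_one_le_left (by positivity) hcount
      _ = ‖(s.map fun γ => Q.eval γ * γ ^ m).sum‖ := by
          rw [hsum, norm_mul, norm_mul, norm_pow, Complex.norm_natCast]
      _ ≤ ∑ j ∈ Finset.range (Q.natDegree + 1), ‖Q.coeff j‖ * (C₀ * R ^ (m + j)) := by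
          rw [hexp]
          refine norm_sum_le_of_le _ fun j _ => ?_
          rw [norm_mul]
          exact mul_le_mul_of_nonneg_left (h _ (by omega)) (norm_nonneg _)
      _ = A * R ^ m := by
          rw [hA, Finset.sum_mul]
          exact Finset.sum_congr rfl fun j _ => by rw [pow_add]; ring
  by_contra hlt
  have h1 : 1 < ‖β‖ / R := (one_lt_div hR).2 (not_le.1 hlt)
  obtain ⟨m, hm, hm'⟩ := ((tendsto_pow_atTop_atTop_of_one_lt h1).eventually_gt_atTop
    (A / ‖Q.eval β‖)).and (Filter.eventually_ge_atTop m₀) |>.exists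
  exact absurd (hbound m hm') (not_le.2 hm)
end PowerSumGrowth

section Weil

theorem trace_pow_char {F : Type*} [Field F] {p : ℕ} [Fact p.Prime] [CharP F p]
    {E : Type*} [Field E] [Finite E] [Algebra F E] (y : E) :
    Algebra.trace F E (y ^ p) = Algebra.trace F E y ^ p := by
  have : CharP E p := charP_of_injective_algebraMap (algebraMap F E).injective p
  apply (algebraMap F E).injective
  rw [map_pow (algebraMap F E), trace_eq_sum_automorphisms, trace_eq_sum_automorphisms,
    sum_pow_char]
  simp

variable {F : Type*} [Field F] [Finite F]

theorem exists_lPower_eq_neg_sum_pow {ψ : AddChar F ℂ} (hψ : ψ ≠ 1) {f : F[X]}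
    (hf : 0 < f.natDegree) (hdF : (f.natDegree : F) ≠ 0) :
    ∃ s : Multiset ℂ, s.card = f.natDegree - 1 ∧
      ∀ k, 0 < k → lPower ψ f k = -(s.map (· ^ k)).sum := by
  obtain ⟨D, hD⟩ := Nat.exists_eq_succ_of_ne_zero hf.ne'
  set P : ℂ[X] := ∑ n ∈ Finset.range (D + 1), C (lCoeff ψ f n) * X ^ (D - n) with hP
  have hcoeff : ∀ i ≤ D, P.coeff (D - i) = lCoeff ψ f i := by
    intro i hi
    rw [hP, finsetSum_coeff, Finset.sum_eq_single_of_mem i (Finset.mem_range.2 (by omega))]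
    · simp
    · intro b hb hbi
      rw [coeff_C_mul_X_pow, if_neg]
      have := Finset.mem_range.1 hb
      omega
  have hle : P.natDegree ≤ D := natDegree_sum_le_of_forall_le _ _ fun n _ =>
    (natDegree_C_mul_X_pow_le _ _).trans (Nat.sub_le _ _)
  have hlead : P.coeff D = 1 := by simpa [lCoeff_zero] using hcoeff 0 (Nat.zero_le _)
  have hmon : P.Monic := monic_of_natDegree_le_of_coeff_eq_one D hle hlead
  have hdeg : P.natDegree = D := le_antisymm hle (le_natDegree_of_ne_zero (by simp [hlead]))
  have hcard : P.roots.card = D := by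
    rw [← (IsAlgClosed.splits P).natDegree_eq_card_roots, hdeg]
  have hesymm : ∀ i, (-1) ^ i * P.roots.esymm i = lCoeff ψ f i := by
    intro i
    rcases le_or_gt i D with hi | hi
    · rw [← hcoeff i hi, coeff_eq_esymm_roots_of_splits (IsAlgClosed.splits P) (by omega),
        hmon.leadingCoeff, hdeg, Nat.sub_sub_self hi, one_mul]
    · rw [lCoeff_eq_zero hψ hf hdF (by omega), Multiset.esymm,
        Multiset.powersetCard_eq_empty _ (by omega)]
      simp
  refine ⟨P.roots, by rw [hcard, hD, Nat.succ_sub_one], fun k hk => ?_⟩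
  refine neg_eq_iff_eq_neg.1 (eq_of_newton_recursion (a := lCoeff ψ f)
    (P := fun k => -lPower ψ f k) (Q := fun k => (P.roots.map (· ^ k)).sum) (lCoeff_zero ψ f)
    (fun k => ?_) (fun k => ?_) hk)
  · rw [mul_lCoeff, ← Finset.sum_neg_distrib]
    exact Finset.sum_congr rfl fun i _ => by ring
  · have := P.roots.mul_esymm_eq_neg_sum k
    simpa only [hesymm] using this

variable {p : ℕ} [Fact p.Prime] [CharP F p]

theorem norm_lPower_two_mul_le {ψ : AddChar F ℂ} (hψ : ψ ≠ 1) (hfrob : ∀ y, ψ (y ^ p) = ψ y)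
    {f : F[X]} (hf : 0 < f.natDegree) (hdF : (f.natDegree : F) ≠ 0) {m : ℕ}
    (hm : (f.natDegree + 1) ^ 2 < m) :
    ‖lPower ψ f (2 * m)‖ ≤ (2 * f.natDegree * p + 1) * (Nat.card F : ℝ) ^ m := by
  have hp : p.Prime := Fact.out
  have hm0 : NeZero (2 * m) := ⟨by omega⟩
  let E := FiniteField.Extension F p (2 * m)
  have : Fintype E := Fintype.ofFinite E
  have : CharP E p := charP_of_injective_algebraMap (algebraMap F E).injective p
  obtain ⟨e, he⟩ : ∃ e : ℕ, Nat.card F = p ^ (e + 1) := by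
    have := Fintype.ofFinite F
    obtain ⟨e, -, he⟩ := FiniteField.card F p
    exact ⟨e - 1, by
      rw [← Fintype.card_eq_nat_card, he, Nat.sub_add_cancel (show 1 ≤ (e : ℕ) from e.pos)]⟩
  have hem : (e + 1) * m - 1 + 1 = (e + 1) * m := Nat.sub_add_cancel (by nlinarith)
  have hcardE : Fintype.card E = p ^ ((e + 1) * m - 1 + 1) * p ^ ((e + 1) * m - 1 + 1) := by
    rw [Fintype.card_eq_nat_card, FiniteField.natCard_extension, he, hem, ← pow_mul, ← pow_add]
    congr 1; ring
  have hpd : Nat.Coprime p f.natDegree :=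
    (Nat.Prime.coprime_iff_not_dvd hp).2 fun h => hdF ((CharP.cast_eq_zero_iff F p _).2 h)
  have hlarge : (f.natDegree + 1) ^ 2 ≤ p ^ ((e + 1) * m - 1) := by
    calc (f.natDegree + 1) ^ 2 ≤ (e + 1) * m - 1 := by
          have : m ≤ (e + 1) * m := Nat.le_mul_of_pos_left _ (by omega)
          omega
      _ ≤ _ := (Nat.lt_pow_self hp.one_lt).le
  let χ : AddChar E ℂ := ψ.compAddMonoidHom (Algebra.trace F E).toAddMonoidHom
  have hχ : ∀ y, χ y = ψ (Algebra.trace F E y) := fun y => rfl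
  have hχ1 : χ ≠ 1 := by
    obtain ⟨y, hy⟩ := AddChar.ne_one_iff.1 hψ
    obtain ⟨z, rfl⟩ := Algebra.trace_surjective F E y
    exact AddChar.ne_one_iff.2 ⟨z, hy⟩
  have hmain := norm_sum_addChar_le_of_stepanov (K := E) (p := p)
    (f := f.map (algebraMap F E)) (by rwa [natDegree_map]) (by rwa [natDegree_map]) hcardE
    (by rwa [natDegree_map]) χ hχ1 (fun y => by rw [hχ, hχ, trace_pow_char, hfrob])
  simp_rw [hχ, eval_map_algebraMap] at hmain
  rw [sum_addChar_trace_eq_lPower, FiniteField.finrank_extension, natDegree_map, hem] at hmain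
  rw [he, Nat.cast_pow, ← pow_mul]
  exact hmain

/-- **Weil's bound** for additive character sums. -/
theorem norm_sum_addChar_eval_le [Fintype F] {ψ : AddChar F ℂ} (hψ : ψ ≠ 1)
    (hfrob : ∀ y, ψ (y ^ p) = ψ y) {f : F[X]} (hf : 0 < f.natDegree)
    (hdF : (f.natDegree : F) ≠ 0) :
    ‖∑ x : F, ψ (f.eval x)‖ ≤ (f.natDegree - 1 : ℕ) * √(Fintype.card F) := by
  obtain ⟨s, hs, hpow⟩ := exists_lPower_eq_neg_sum_pow hψ hf hdF
  have hle : ∀ α ∈ s, ‖α‖ ≤ √(Fintype.card F) := by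
    intro α hα
    refine Real.le_sqrt_of_sq_le ?_
    rw [← norm_pow]
    refine norm_le_of_norm_sum_pow_le (s := s.map (· ^ 2)) (C₀ := 2 * f.natDegree * p + 1)
      (m₀ := (f.natDegree + 1) ^ 2 + 1) (by exact_mod_cast Fintype.card_pos) (fun m hm => ?_)
      (Multiset.mem_map_of_mem _ hα)
    have h := norm_lPower_two_mul_le (p := p) hψ hfrob hf hdF (m := m) (by omega)
    rw [hpow _ (by omega), norm_neg] at h
    simpa only [Multiset.map_map, Function.comp_def, ← pow_mul, Fintype.card_eq_nat_card] using h
  have h1 : ∑ x : F, ψ (f.eval x) = lPower ψ f 1 := by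
    rw [← Module.finrank_self F, ← sum_addChar_trace_eq_lPower (E := F)]
    simp
  rw [h1, hpow 1 one_pos, norm_neg]
  simp only [pow_one, Multiset.map_id']
  calc ‖s.sum‖ ≤ (s.map norm).sum := norm_multiset_sum_le s
    _ ≤ (s.map norm).card • √(Fintype.card F) := Multiset.sum_le_card_nsmul _ _ (by
        intro y hy
        obtain ⟨α, hα, rfl⟩ := Multiset.mem_map.1 hy
        exact hle α hα)
    _ = _ := by rw [Multiset.card_map, hs, nsmul_eq_mul]
end Weil

section FrobeniusInvariantCharacter

/-- A finite field carries a nontrivial Frobenius-invariant additive character. -/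
theorem exists_addChar_ne_one_pow_char (F : Type*) [Field F] [Finite F] (p : ℕ) [Fact p.Prime]
    [CharP F p] : ∃ ψ : AddChar F ℂ, ψ ≠ 1 ∧ ∀ y, ψ (y ^ p) = ψ y := by
  let := ZMod.algebra F p
  refine ⟨ZMod.stdAddChar.compAddMonoidHom (Algebra.trace (ZMod p) F).toAddMonoidHom, ?_, ?_⟩
  · intro h
    obtain ⟨y, hy⟩ := Algebra.trace_surjective (ZMod p) F 1
    have h1 : ZMod.stdAddChar (Algebra.trace (ZMod p) F y) = 1 := DFunLike.congr_fun h y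
    rw [hy, ← AddChar.map_zero_eq_one (ZMod.stdAddChar (N := p))] at h1
    exact one_ne_zero (ZMod.injective_stdAddChar h1)
  · intro y
    change ZMod.stdAddChar (Algebra.trace (ZMod p) F (y ^ p)) =
      ZMod.stdAddChar (Algebra.trace (ZMod p) F y)
    rw [trace_pow_char, ZMod.pow_card]

end FrobeniusInvariantCharacter

section CayleySpectrum

variable {V : Type*} [AddCommGroup V] [Fintype V]

/-- A function orthogonal to all nontrivial characters is constant. -/
theorem eq_of_sum_addChar_mul_eq_zero {v : V → ℂ}
    (h : ∀ χ : AddChar V ℂ, χ ≠ 1 → ∑ a, χ a * v a = 0) (x y : V) : v x = v y := by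
  classical
  have key : ∀ z : V, (Fintype.card V : ℂ) * v z = ∑ a, v a := by
    intro z
    have h1 : ∑ χ : AddChar V ℂ, χ (-z) * ∑ a, χ a * v a = Fintype.card V * v z := by
      simp_rw [Finset.mul_sum]
      rw [Finset.sum_comm]
      have : ∀ a, ∑ χ : AddChar V ℂ, χ (-z) * (χ a * v a) =
          if a = z then Fintype.card V * v z else 0 := by
        intro a
        simp_rw [← mul_assoc, ← AddChar.map_add_eq_mul, ← Finset.sum_mul,
          AddChar.sum_apply_eq_ite, neg_add_eq_zero, eq_comm (a := z)]
        split_ifs with h <;> simp [h]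
      simp [this]
    rw [← h1, Finset.sum_eq_single (1 : AddChar V ℂ)]
    · simp
    · intro χ _ hχ
      rw [h χ hχ, mul_zero]
    · simp
  have hc : (Fintype.card V : ℂ) ≠ 0 := by
    have : Nonempty V := ⟨x⟩
    exact_mod_cast Fintype.card_ne_zero
  exact mul_left_cancel₀ hc ((key x).trans (key y).symm)

variable {G : SimpleGraph V} [DecidableRel G.Adj] {D : Finset V}

/-- An eigenvector of a Cayley graph is orthogonal to the characters belonging to other
eigenvalues. -/
theorem sum_addChar_mul_eq_zero_of_eigenvector (hG : ∀ a b, G.Adj a b ↔ b - a ∈ D)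
    {v : V → ℝ} {μ : ℝ} (hv : (G.adjMatrix ℝ).mulVec v = μ • v) {χ : AddChar V ℂ}
    (hχ : ∑ δ ∈ D, χ δ ≠ μ) : ∑ a, χ a * (v a : ℂ) = 0 := by
  classical
  have h1 : ∀ a, (μ : ℂ) * v a = ∑ b, if a - b ∈ D then (v b : ℂ) else 0 := by
    intro a
    have := congrFun hv a
    rw [SimpleGraph.adjMatrix_mulVec_apply, Pi.smul_apply, smul_eq_mul] at this
    rw [← Complex.ofReal_mul, ← this, Complex.ofReal_sum, ← Finset.sum_filter]
    refine Finset.sum_congr ?_ fun _ _ => rfl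
    ext b
    simp [← hG, G.adj_comm a b]
  have h2 : (μ : ℂ) * ∑ a, χ a * (v a : ℂ) = (∑ δ ∈ D, χ δ) * ∑ a, χ a * (v a : ℂ) := by
    calc (μ : ℂ) * ∑ a, χ a * (v a : ℂ)
        = ∑ a, ∑ b, if a - b ∈ D then χ a * (v b : ℂ) else 0 := by
          rw [Finset.mul_sum]
          refine Finset.sum_congr rfl fun a _ => ?_
          rw [mul_left_comm, h1, Finset.mul_sum]
          exact Finset.sum_congr rfl fun b _ => by rw [mul_ite, mul_zero]
      _ = ∑ b, ∑ a, if a - b ∈ D then χ a * (v b : ℂ) else 0 := Finset.sum_comm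
      _ = ∑ b, (∑ δ ∈ D, χ δ) * (χ b * (v b : ℂ)) := by
          refine Finset.sum_congr rfl fun b _ => ?_
          rw [← Fintype.sum_equiv (Equiv.addRight b) (fun δ => if δ ∈ D then χ (δ + b) * v b else 0)
            _ (fun δ => by simp), Finset.sum_mul, ← Finset.sum_filter]
          refine Finset.sum_congr (by ext; simp) fun δ _ => ?_
          rw [AddChar.map_add_eq_mul, mul_assoc]
      _ = _ := by rw [Finset.mul_sum]
  by_contra h0
  exact hχ (mul_right_cancel₀ h0 h2).symm

theorem eq_of_eigenvector_of_sum_addChar_ne (hG : ∀ a b, G.Adj a b ↔ b - a ∈ D)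
    {v : V → ℝ} {μ : ℝ} (hv : (G.adjMatrix ℝ).mulVec v = μ • v)
    (h : ∀ χ : AddChar V ℂ, χ ≠ 1 → ∑ δ ∈ D, χ δ ≠ μ) (x y : V) : v x = v y :=
  Complex.ofReal_injective <| eq_of_sum_addChar_mul_eq_zero (v := fun a => (v a : ℂ))
    (fun χ hχ => sum_addChar_mul_eq_zero_of_eigenvector hG hv (h χ hχ)) x y

/-- A Cayley graph whose connection set lies in the kernel of no nontrivial character is
connected. -/
theorem connected_of_exists_addChar_ne_one (hG : ∀ a b, G.Adj a b ↔ b - a ∈ D)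
    (h : ∀ χ : AddChar V ℂ, χ ≠ 1 → ∃ δ ∈ D, χ δ ≠ 1) : G.Connected := by
  classical
  have hsum : ∀ χ : AddChar V ℂ, χ ≠ 1 → ∑ δ ∈ D, χ δ ≠ ((D.card : ℝ) : ℂ) := by
    intro χ hχ hs
    obtain ⟨δ, hδ, hne⟩ := h χ hχ
    have hre : ∀ x, (χ x).re ≤ 1 := fun x => (Complex.re_le_norm _).trans (χ.norm_apply x).le
    have h1 : ∑ δ ∈ D, (χ δ).re = ∑ δ ∈ D, (1 : ℝ) := by
      rw [← Complex.re_sum, hs]; simp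
    have h2 := (Finset.sum_eq_sum_iff_of_le fun x _ => hre x).1 h1 δ hδ
    refine hne (Complex.ext h2 ?_)
    have h3 := χ.norm_apply δ
    rw [← sq_eq_sq₀ (norm_nonneg _) zero_le_one, Complex.sq_norm, Complex.normSq_apply, h2] at h3
    simp only [Complex.one_im]
    nlinarith
  have hreach : ∀ x y, G.Reachable x y := by
    intro x y
    set v : V → ℝ := fun z => if G.Reachable x z then 1 else 0 with hvdef
    have hv : (G.adjMatrix ℝ).mulVec v = (D.card : ℝ) • v := by
      ext a
      rw [SimpleGraph.adjMatrix_mulVec_apply]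
      have : ∀ b ∈ G.neighborFinset a, v b = v a := by
        intro b hb
        have hab : G.Adj a b := by simpa using hb
        have : G.Reachable x b ↔ G.Reachable x a :=
          ⟨fun hr => hr.trans hab.symm.reachable, fun hr => hr.trans hab.reachable⟩
        simp only [hvdef, this]
      rw [Finset.sum_congr rfl this, Finset.sum_const, nsmul_eq_mul, Pi.smul_apply, smul_eq_mul]
      congr 2
      refine Finset.card_bij (fun b _ => b - a) ?_ ?_ ?_
      · intro b hb; exact (hG a b).1 (by simpa using hb)
      · intro b _ c _ hbc; simpa using hbc
      · intro δ hδ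
        exact ⟨a + δ, by simpa [hG] using hδ, by simp⟩
    have := eq_of_eigenvector_of_sum_addChar_ne hG hv hsum x y
    by_contra hxy
    simp [hvdef, hxy] at this
  exact { preconnected := hreach, nonempty := ⟨0⟩ }

end CayleySpectrum

section SecondEigenvalue

/-- In a sorted list with at most one entry of absolute value larger than `B`, every entry that
is neither first nor last has absolute value at most `B`. -/
theorem abs_getElem_le_of_countP_le_one {L : List ℝ} (hL : L.Pairwise (· ≤ ·))
    {B : ℝ} (hB : L.countP (fun x => B < |x|) ≤ 1) {i : ℕ} (hi : 0 < i) (hi' : i + 1 < L.length) :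
    |L[i]| ≤ B := by
  by_contra! hlt
  have hmono : ∀ (a b : ℕ) (hab : a < b) (hb : b < L.length), L[a] ≤ L[b] := fun a b hab hb =>
    List.pairwise_iff_getElem.1 hL a b (hab.trans hb) hb hab
  have hpair : ∀ a (ha : a + 1 < L.length), B < |L[a]| → B < |L[a + 1]| → False := by
    intro a ha h1 h2
    have hsub : [L[a], L[a + 1]].Sublist L := by
      have := (List.take_sublist 2 (L.drop a)).trans (List.drop_sublist a L)
      rwa [List.drop_eq_getElem_cons (by omega), List.drop_eq_getElem_cons (by omega),
        List.take_succ_cons, List.take_succ_cons, List.take_zero] at this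
    have := hsub.countP_le (p := fun x => decide (B < |x|))
    simp [h1, h2] at this
    omega
  rcases lt_abs.1 hlt with h | h
  · refine hpair i hi' hlt ((h.trans_le (hmono i (i + 1) (by omega) hi')).trans_le (le_abs_self _))
  · obtain ⟨j, rfl⟩ : ∃ j, i = j + 1 := ⟨i - 1, by omega⟩
    refine hpair j (by omega) (lt_of_lt_of_le ?_ (neg_le_abs _)) hlt
    have := hmono j (j + 1) (by omega) (by omega)
    linarith

theorem abs_secondLargestEig_le_of_card_le_one {V : Type} [Fintype V] [DecidableEq V]
    {A : Matrix V V ℝ} (hA : A.IsHermitian) (hV : 3 ≤ Fintype.card V) {B : ℝ}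
    (h : ∀ i j, B < |hA.eigenvalues i| → B < |hA.eigenvalues j| → i = j) :
    |secondLargestEig hA| ≤ B := by
  have hlen : (eigSorted hA).length = Fintype.card V := by simp [eigSorted]
  have hcount : (eigSorted hA).countP (fun x => B < |x|) ≤ 1 := by
    rw [← Multiset.coe_countP, eigSorted, Multiset.sort_eq, Multiset.countP_map,
      ← Finset.filter_val, Finset.card_val, Finset.card_le_one]
    intro i hi j hj
    simp only [Finset.mem_filter, Finset.mem_univ, true_and] at hi hj
    exact h i j hi hj
  rw [secondLargestEig, List.getD_eq_getElem _ _ (by omega)]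
  exact abs_getElem_le_of_countP_le_one (L := eigSorted hA) (Multiset.pairwise_sort _ _) hcount
    (by omega) (by omega)

/-- The second largest eigenvalue of a Cayley graph is bounded by its nontrivial character sums. -/
theorem abs_secondLargestEig_le_of_norm_sum_addChar_le {V : Type} [AddCommGroup V] [Fintype V]
    [DecidableEq V] {G : SimpleGraph V} [DecidableRel G.Adj] {D : Finset V}
    (hG : ∀ a b, G.Adj a b ↔ b - a ∈ D) (hA : (G.adjMatrix ℝ).IsHermitian)
    (hV : 3 ≤ Fintype.card V) {B : ℝ}
    (hB : ∀ χ : AddChar V ℂ, χ ≠ 1 → ‖∑ δ ∈ D, χ δ‖ ≤ B) : |secondLargestEig hA| ≤ B := by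
  refine abs_secondLargestEig_le_of_card_le_one hA hV fun i j hi hj => ?_
  by_contra hij
  have hconst : ∀ l, B < |hA.eigenvalues l| → ∀ x, hA.eigenvectorBasis l x =
      hA.eigenvectorBasis l 0 := by
    intro l hl x
    refine eq_of_eigenvector_of_sum_addChar_ne hG (hA.mulVec_eigenvectorBasis l)
      (fun χ hχ hs => ?_) x 0
    have := hB χ hχ
    rw [hs, Complex.norm_real, Real.norm_eq_abs] at this
    exact absurd this hl.not_ge
  have hne : ∀ l, B < |hA.eigenvalues l| → hA.eigenvectorBasis l 0 ≠ 0 := by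
    intro l hl h0
    refine hA.eigenvectorBasis.orthonormal.ne_zero l ?_
    ext x
    simp [hconst l hl x, h0]
  have horth : inner ℝ (hA.eigenvectorBasis i) (hA.eigenvectorBasis j) = 0 :=
    hA.eigenvectorBasis.orthonormal.2 hij
  rw [PiLp.inner_apply] at horth
  simp only [hconst i hi, hconst j hj, Finset.sum_const, Finset.card_univ, nsmul_eq_mul,
    mul_eq_zero, RCLike.inner_apply, conj_trivial] at horth
  rcases horth with h | h | h
  · have : Fintype.card V = 0 := by exact_mod_cast h
    omega
  · exact hne j hj h
  · exact hne i hi h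

end SecondEigenvalue

section PolynomialValues

variable {F : Type*} [Field F]

theorem coeff_taylor_one_sub_self {h : F[X]} {d : ℕ} (hd : h.natDegree = d + 1) :
    (taylor 1 h - h).coeff d = (d + 1 : ℕ) * h.leadingCoeff := by
  have hdeg : (hasseDeriv d h).natDegree < 2 :=
    (natDegree_hasseDeriv_le h d).trans_lt (by omega)
  rw [coeff_sub, taylor_coeff, eval_eq_sum_range' hdeg, leadingCoeff, hd]
  simp [Finset.sum_range_succ, hasseDeriv_coeff, add_comm 1 d]

theorem natDegree_taylor_one_sub_self_le {h : F[X]} {d : ℕ} (hd : h.natDegree = d + 1) :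
    (taylor 1 h - h).natDegree ≤ d := by
  rw [natDegree_le_iff_coeff_eq_zero]
  intro n hn
  rcases (Nat.succ_le_of_lt hn).eq_or_lt with rfl | hlt
  · rw [coeff_sub, Nat.succ_eq_add_one, ← hd, coeff_taylor_natDegree, leadingCoeff, sub_self]
  · refine coeff_eq_zero_of_natDegree_lt ((natDegree_sub_le _ _).trans_lt ?_)
    rw [natDegree_taylor, max_self, hd]
    exact hlt

/-- A nontrivial additive character is not constant on the values of a polynomial whose degree is
positive and smaller than the characteristic. -/
theorem exists_addChar_eval_ne_one {p : ℕ} [CharP F p] {ψ : AddChar F ℂ} (hψ : ψ ≠ 1)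
    {h : F[X]} (h0 : 0 < h.natDegree) (hp : h.natDegree < p) : ∃ s, ψ (h.eval s) ≠ 1 := by
  obtain ⟨d, hd⟩ : ∃ d, h.natDegree = d + 1 := ⟨h.natDegree - 1, by omega⟩
  induction d generalizing h with
  | zero =>
    obtain ⟨a, ha, b, rfl⟩ := natDegree_eq_one.1 hd
    by_contra! hall
    refine hψ (DFunLike.ext _ _ fun u => ?_)
    have := hall ((u - b) / a)
    simpa [mul_div_cancel₀ _ ha] using this
  | succ d ih =>
    by_contra! hall
    have hc : (taylor 1 h - h).coeff (d + 1) ≠ 0 := by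
      rw [coeff_taylor_one_sub_self hd]
      refine mul_ne_zero ?_ (leadingCoeff_ne_zero.2 fun h' => by simp [h'] at hd)
      rw [Ne, CharP.cast_eq_zero_iff F p, ← hd]
      exact fun hdvd => absurd (Nat.le_of_dvd h0 hdvd) hp.not_ge
    have hdeg : (taylor 1 h - h).natDegree = d + 1 :=
      le_antisymm (natDegree_taylor_one_sub_self_le hd) (le_natDegree_of_ne_zero hc)
    obtain ⟨s, hs⟩ := ih (by omega) (by omega) hdeg
    rw [eval_sub, taylor_eval, AddChar.map_sub_eq_div, hall, hall, div_one] at hs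
    exact hs rfl

theorem exists_ne_zero_addChar_eval_ne_one [Fintype F] {p : ℕ} [CharP F p] {ψ : AddChar F ℂ}
    (hψ : ψ ≠ 1) {h : F[X]} (h0 : 0 < h.natDegree) (hp : h.natDegree < p)
    (hF : h.eval 0 = 0 ∨ (h.natDegree ≤ 1 ∧ 3 ≤ Fintype.card F)) :
    ∃ s, s ≠ 0 ∧ ψ (h.eval s) ≠ 1 := by
  classical
  rcases hF with hz | ⟨h1, hF⟩
  · obtain ⟨s, hs⟩ := exists_addChar_eval_ne_one hψ h0 hp
    refine ⟨s, ?_, hs⟩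
    rintro rfl
    simp [hz] at hs
  · obtain ⟨a, ha, b, rfl⟩ := natDegree_eq_one.1 (le_antisymm h1 h0)
    by_contra! hall
    have hb : ∀ u, u ≠ b → ψ u = 1 := by
      intro u hu
      have := hall ((u - b) / a) (div_ne_zero (sub_ne_zero.2 hu) ha)
      simpa [mul_div_cancel₀ _ ha] using this
    obtain ⟨c, hc⟩ : ∃ c, c ∉ ({0, b} : Finset F) := by
      by_contra! hcon
      have := (Finset.card_le_card (fun x _ => hcon x : Finset.univ ⊆ _)).trans Finset.card_le_two
      rw [Finset.card_univ] at this
      omega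
    simp only [Finset.mem_insert, Finset.mem_singleton, not_or] at hc
    have hψb : ψ b = 1 := by
      have := hb (c + b) (by simpa using hc.1)
      rwa [AddChar.map_add_eq_mul, hb c hc.2, one_mul] at this
    refine hψ (DFunLike.ext _ _ fun u => ?_)
    by_cases hu : u = b
    · rw [hu, hψb, AddChar.one_apply]
    · rw [hb u hu, AddChar.one_apply]

end PolynomialValues

section BilinearSums

variable {F : Type*} [Field F] {ι : Type*} [Fintype ι]

/-- The polynomial `∑ i, w i * u i (t) * v i` in the remaining variable. -/
noncomputable def fiberPoly (u v : ι → F[X]) (w : ι → F) (t : F) : F[X] :=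
  ∑ i, C (w i * (u i).eval t) * v i

/-- The polynomial in `t` giving the `j`-th coefficient of `fiberPoly u v w t`. -/
noncomputable def fiberCoeff (u v : ι → F[X]) (w : ι → F) (j : ℕ) : F[X] :=
  ∑ i, C (w i * (v i).coeff j) * u i

variable {u v : ι → F[X]} {w : ι → F}

theorem eval_fiberPoly (s t : F) :
    (fiberPoly u v w t).eval s = ∑ i, w i * ((v i).eval s * (u i).eval t) := by
  simp only [fiberPoly, eval_finsetSum, eval_mul, eval_C]
  exact Finset.sum_congr rfl fun i _ => by ring

theorem coeff_fiberPoly (t : F) (j : ℕ) :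
    (fiberPoly u v w t).coeff j = (fiberCoeff u v w j).eval t := by
  simp only [fiberPoly, fiberCoeff, eval_finsetSum, eval_mul, eval_C, finsetSum_coeff, coeff_C_mul]
  exact Finset.sum_congr rfl fun i _ => by ring

theorem natDegree_fiberPoly_le {n : ℕ} (hv : ∀ i, (v i).natDegree ≤ n) (t : F) :
    (fiberPoly u v w t).natDegree ≤ n :=
  natDegree_sum_le_of_forall_le _ _ fun i _ => (natDegree_C_mul_le _ _).trans (hv i)

theorem natDegree_fiberCoeff_le {n : ℕ} (hu : ∀ i, (u i).natDegree ≤ n) (j : ℕ) :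
    (fiberCoeff u v w j).natDegree ≤ n :=
  natDegree_sum_le_of_forall_le _ _ fun i _ => (natDegree_C_mul_le _ _).trans (hu i)

variable [Fintype F]

theorem norm_sum_erase_addChar_eval_le [DecidableEq F] {p : ℕ} [Fact p.Prime] [CharP F p]
    {ψ : AddChar F ℂ} (hψ : ψ ≠ 1) (hfrob : ∀ y, ψ (y ^ p) = ψ y) {h : F[X]} {n : ℕ}
    (h0 : 0 < h.natDegree) (hn : h.natDegree ≤ n) (hp : n < p) :
    ‖∑ s ∈ Finset.univ.erase 0, ψ (h.eval s)‖ ≤ n * √(Fintype.card F) := by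
  have hW := norm_sum_addChar_eval_le hψ hfrob h0 (by
    rw [Ne, CharP.cast_eq_zero_iff F p]
    exact fun hdvd => absurd (Nat.le_of_dvd h0 hdvd) (by omega))
  have hq : 1 ≤ √(Fintype.card F : ℝ) := by
    rw [Real.one_le_sqrt]
    exact_mod_cast Fintype.card_pos
  rw [Finset.sum_erase_eq_sub (Finset.mem_univ 0)]
  refine (norm_sub_le _ _).trans ?_
  rw [AddChar.norm_apply]
  rw [Nat.cast_sub h0, Nat.cast_one] at hW
  have : (h.natDegree : ℝ) ≤ n := by exact_mod_cast hn
  nlinarith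

/-- A Weil bound for the sums over `s ≠ 0` and `t` of `ψ (∑ i, w i * v i (s) * u i (t))`. -/
theorem norm_sum_addChar_fiberPoly_le [DecidableEq F] {p : ℕ} [Fact p.Prime] [CharP F p]
    {ψ : AddChar F ℂ} (hψ : ψ ≠ 1) (hfrob : ∀ y, ψ (y ^ p) = ψ y) {m n : ℕ}
    (hu : ∀ i, (u i).natDegree ≤ m) (hv : ∀ i, (v i).natDegree ≤ n) (hn : n < p)
    {j : ℕ} (hj : 0 < j) (hw : fiberCoeff u v w j ≠ 0) :
    ‖∑ t, ∑ s ∈ Finset.univ.erase 0, ψ ((fiberPoly u v w t).eval s)‖ ≤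
      m * Fintype.card F + n * (Fintype.card F * √(Fintype.card F)) := by
  set q := Fintype.card F
  have hterm : ∀ t, ‖∑ s ∈ Finset.univ.erase 0, ψ ((fiberPoly u v w t).eval s)‖ ≤
      (if t ∈ (fiberCoeff u v w j).roots.toFinset then (q : ℝ) else 0) + n * √q := by
    intro t
    split_ifs with ht
    · refine (norm_sum_le _ _).trans ?_
      simp only [AddChar.norm_apply, Finset.sum_const, nsmul_eq_mul, mul_one]
      have h1 : ((Finset.univ.erase (0 : F)).card : ℝ) ≤ q := by
        exact_mod_cast (Finset.card_erase_le).trans_eq Finset.card_univ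
      have : 0 ≤ (n : ℝ) * √q := by positivity
      linarith
    · rw [zero_add]
      refine norm_sum_erase_addChar_eval_le hψ hfrob ?_ (natDegree_fiberPoly_le hv t) hn
      have hne : (fiberPoly u v w t).coeff j ≠ 0 := by
        rw [coeff_fiberPoly]
        simpa [hw] using ht
      exact hj.trans_le (le_natDegree_of_ne_zero hne)
  refine (norm_sum_le _ _).trans ((Finset.sum_le_sum fun t _ => hterm t).trans ?_)
  rw [Finset.sum_add_distrib, Finset.sum_ite_mem, Finset.univ_inter, Finset.sum_const,
    Finset.sum_const, Finset.card_univ, nsmul_eq_mul, nsmul_eq_mul]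
  have hcard : ((fiberCoeff u v w j).roots.toFinset.card : ℝ) ≤ m := by
    exact_mod_cast (Multiset.toFinset_card_le _).trans
      ((card_roots' _).trans (natDegree_fiberCoeff_le hu j))
  have : (0 : ℝ) ≤ q := by positivity
  nlinarith

theorem exists_addChar_fiberPoly_ne_one {p : ℕ} [CharP F p] {ψ : AddChar F ℂ} (hψ : ψ ≠ 1)
    {m n : ℕ} (hu : ∀ i, (u i).natDegree ≤ m) (hm : m < Fintype.card F)
    (hv : ∀ i, (v i).natDegree ≤ n) (hn : n < p) {j : ℕ} (hj : 0 < j)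
    (hw : fiberCoeff u v w j ≠ 0)
    (hF : (∀ i, (v i).eval 0 = 0) ∨ (n ≤ 1 ∧ 3 ≤ Fintype.card F)) :
    ∃ s t, s ≠ 0 ∧ ψ ((fiberPoly u v w t).eval s) ≠ 1 := by
  obtain ⟨t, ht⟩ : ∃ t, (fiberCoeff u v w j).eval t ≠ 0 := by
    by_contra! hall
    exact hw (eq_zero_of_natDegree_lt_card_of_eval_eq_zero _ Function.injective_id hall
      ((natDegree_fiberCoeff_le hu j).trans_lt hm))
  rw [← coeff_fiberPoly] at ht
  have hdeg := natDegree_fiberPoly_le (u := u) (w := w) hv t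
  obtain ⟨s, hs, hne⟩ := exists_ne_zero_addChar_eval_ne_one hψ
    (hj.trans_le (le_natDegree_of_ne_zero ht)) (hdeg.trans_lt hn) (by
      rcases hF with hF | ⟨h1, h3⟩
      · exact Or.inl (by simp [eval_fiberPoly, hF])
      · exact Or.inr ⟨hdeg.trans h1, h3⟩)
  exact ⟨s, t, hs, hne⟩

end BilinearSums

section CharactersOfVectors

variable {F : Type*} [Field F] [Finite F] {ι : Type*} [Fintype ι]

/-- Every additive character of `F^ι` is `a ↦ ψ (∑ i, w i * a i)` for a fixed nontrivial `ψ`. -/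
theorem exists_addChar_apply_eq_sum_mul {ψ : AddChar F ℂ} (hψ : ψ ≠ 1)
    {χ : AddChar (ι → F) ℂ} (hχ : χ ≠ 1) :
    ∃ w : ι → F, w ≠ 0 ∧ ∀ a, χ a = ψ (∑ i, w i * a i) := by
  classical
  have := Fintype.ofFinite F
  let Φ : (ι → F) → AddChar (ι → F) ℂ := fun w =>
    { toFun := fun a => ψ (∑ i, w i * a i)
      map_zero_eq_one' := by simp
      map_add_eq_mul' := fun a b => by
        simp [mul_add, Finset.sum_add_distrib, AddChar.map_add_eq_mul] }
  have hinj : Function.Injective Φ := by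
    intro w w' hww
    by_contra hne
    obtain ⟨i, hi⟩ := Function.ne_iff.1 hne
    refine hψ (DFunLike.ext _ _ fun y => ?_)
    set c := y / (w i - w' i) with hc
    have h1 : ψ (∑ l, w l * (Pi.single i c : ι → F) l) =
        ψ (∑ l, w' l * (Pi.single i c : ι → F) l) := DFunLike.congr_fun hww _
    simp only [Pi.single_apply, mul_ite, mul_zero, Finset.sum_ite_eq', Finset.mem_univ,
      if_true] at h1
    rw [AddChar.one_apply, ← mul_div_cancel₀ y (sub_ne_zero.2 hi), ← hc, sub_mul,
      AddChar.map_sub_eq_div, h1, div_self]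
    exact norm_ne_zero_iff.1 (by simp)
  obtain ⟨w, hw⟩ := ((Fintype.bijective_iff_injective_and_card Φ).2
    ⟨hinj, AddChar.card_eq.symm⟩).2 χ
  refine ⟨w, ?_, fun a => by rw [← hw]; rfl⟩
  rintro rfl
  refine hχ ?_
  rw [← hw]
  ext a
  change ψ (∑ i, 0 * a i) = 1
  simp

end CharactersOfVectors

section ConnectionSet

variable {F : Type} [Field F] {k : ℕ}

/-- The family `1, X, f₃, …, f_k`. -/
noncomputable def directionPoly (f : Fin k → F[X]) (i : Fin k) : F[X] :=
  if (i : ℕ) = 0 then 1 else if (i : ℕ) = 1 then X else f i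

/-- The family `X, X, g₃, …, g_k`. -/
noncomputable def scalePoly (g : Fin k → F[X]) (i : Fin k) : F[X] :=
  if (i : ℕ) < 2 then X else g i

variable {f g : Fin k → F[X]}

theorem directionPoly_of_two_le {i : Fin k} (hi : 2 ≤ (i : ℕ)) : directionPoly f i = f i := by
  rw [directionPoly, if_neg (by omega), if_neg (by omega)]

theorem scalePoly_of_two_le {i : Fin k} (hi : 2 ≤ (i : ℕ)) : scalePoly g i = g i := by
  rw [scalePoly, if_neg (by omega)]

theorem natDegree_directionPoly_le {n : ℕ} (hn : 1 ≤ n)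
    (h : ∀ i : Fin k, 2 ≤ (i : ℕ) → (f i).natDegree ≤ n) (i : Fin k) :
    (directionPoly f i).natDegree ≤ n := by
  rw [directionPoly]
  split_ifs with h0 h1
  · simp
  · simpa using hn
  · exact h i (by omega)

theorem natDegree_scalePoly_le {n : ℕ} (hn : 1 ≤ n)
    (h : ∀ i : Fin k, 2 ≤ (i : ℕ) → (g i).natDegree ≤ n) (i : Fin k) :
    (scalePoly g i).natDegree ≤ n := by
  rw [scalePoly]
  split_ifs with h0
  · simpa using hn
  · exact h i (by omega)

theorem exists_fiberCoeff_ne_zero (hk : 3 ≤ k)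
    (hcond : (LinearIndependent F (directionPoly f) ∧
        ∀ i : Fin k, 2 ≤ (i : ℕ) → (g i).coeff 1 ≠ 0) ∨
      (LinearIndependent F (fun i : {i : Fin k // 2 ≤ (i : ℕ)} => f i) ∧
        ∃ j, 2 ≤ j ∧ ∀ i : Fin k, 2 ≤ (i : ℕ) → (g i).coeff j ≠ 0))
    {w : Fin k → F} (hw : w ≠ 0) :
    ∃ j, 0 < j ∧ fiberCoeff (directionPoly f) (scalePoly g) w j ≠ 0 := by
  rcases hcond with ⟨hli, hg⟩ | ⟨hli, j, hj, hg⟩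
  · refine ⟨1, one_pos, fun h0 => hw (funext fun i => ?_)⟩
    have h1 := Fintype.linearIndependent_iff.1 hli (fun i => w i * (scalePoly g i).coeff 1)
      (by simpa only [fiberCoeff, smul_eq_C_mul] using h0) i
    refine (mul_eq_zero.1 h1).resolve_right ?_
    rw [scalePoly]
    split_ifs with hi
    · simp
    · exact hg i (by omega)
  · by_cases hw2 : ∀ i : Fin k, 2 ≤ (i : ℕ) → w i = 0
    · refine ⟨1, one_pos, fun h0 => hw (funext fun i => ?_)⟩
      rw [fiberCoeff, Fintype.sum_eq_add (⟨0, by omega⟩ : Fin k) ⟨1, by omega⟩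
        (by simp [Fin.ext_iff])] at h0
      · simp only [directionPoly, scalePoly, if_true, one_ne_zero, if_false, coeff_X_one, mul_one,
          Nat.zero_lt_two, Nat.one_lt_two] at h0
        have hc0 := congrArg (coeff · 0) h0
        have hc1 := congrArg (coeff · 1) h0
        simp only [coeff_add, coeff_C_zero, coeff_C_mul, coeff_X_zero, mul_zero, add_zero,
          coeff_zero, coeff_X_one, mul_one, coeff_C_succ, zero_add] at hc0 hc1
        obtain ⟨i, hi⟩ := i
        match i, hi with
        | 0, _ => exact hc0
        | 1, _ => exact hc1
        | i + 2, _ => exact hw2 _ (by simp)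
      · rintro i ⟨hi0, hi1⟩
        rw [hw2 i (by
          simp only [ne_eq, Fin.ext_iff] at hi0 hi1
          omega)]
        simp
    · refine ⟨j, by omega, fun h0 => hw2 fun i hi => ?_⟩
      have hz : ∀ i : Fin k, ¬ 2 ≤ (i : ℕ) →
          C (w i * (scalePoly g i).coeff j) * directionPoly f i = 0 := by
        intro i hi
        rw [scalePoly, if_pos (by omega), coeff_X_of_ne_one (by omega)]
        simp
      rw [fiberCoeff, ← Finset.sum_filter_of_ne (p := fun i : Fin k => 2 ≤ (i : ℕ))
        (fun i _ hne => not_not.1 fun h => hne (hz i h)),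
        Finset.sum_subtype (p := fun i : Fin k => 2 ≤ (i : ℕ)) _ (by simp)] at h0
      have h1 := Fintype.linearIndependent_iff.1 hli (fun i => w i * (g i).coeff j) (by
        rw [← h0]
        refine Finset.sum_congr rfl fun i _ => ?_
        rw [scalePoly_of_two_le i.2, directionPoly_of_two_le i.2, smul_eq_C_mul]) ⟨i, hi⟩
      exact (mul_eq_zero.1 h1).resolve_right (hg i hi)

variable [Fintype F] [DecidableEq F]

/-- The vectors `(s, s t, g₃(s) f₃(t), …, g_k(s) f_k(t))` with `s ≠ 0`. -/
noncomputable def connectionSet (f g : Fin k → F[X]) : Finset (Fin k → F) :=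
  (Finset.univ ×ˢ Finset.univ.erase 0).image
    fun x i => (scalePoly g i).eval x.2 * (directionPoly f i).eval x.1

theorem mem_connectionSet (h₀ : 0 < k) (h₁ : 1 < k) {δ : Fin k → F} :
    δ ∈ connectionSet f g ↔ δ ⟨0, h₀⟩ ≠ 0 ∧ ∀ i : Fin k, 2 ≤ (i : ℕ) →
      δ i = (g i).eval (δ ⟨0, h₀⟩) *
        (f i).eval (δ ⟨1, h₁⟩ / δ ⟨0, h₀⟩) := by
  simp only [connectionSet, Finset.mem_image, Finset.mem_product, Finset.mem_univ, true_and,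
    Finset.mem_erase, and_true, Prod.exists]
  constructor
  · rintro ⟨t, s, hs, rfl⟩
    refine ⟨by simpa [scalePoly, directionPoly] using hs, fun i hi => ?_⟩
    beta_reduce
    rw [scalePoly_of_two_le hi, directionPoly_of_two_le hi]
    simp [scalePoly, directionPoly, hs]
  · rintro ⟨h0, h⟩
    refine ⟨δ ⟨1, h₁⟩ / δ ⟨0, h₀⟩, δ ⟨0, h₀⟩, h0, funext fun i => ?_⟩
    obtain ⟨i, hi⟩ := i
    match i, hi with
    | 0, _ => simp [scalePoly, directionPoly]
    | 1, _ => simp [scalePoly, directionPoly, mul_div_cancel₀ _ h0]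
    | i + 2, hi =>
      rw [scalePoly_of_two_le (by simp), directionPoly_of_two_le (by simp)]
      exact (h ⟨i + 2, hi⟩ (by simp)).symm

theorem sum_connectionSet (hk : 3 ≤ k) (φ : (Fin k → F) → ℂ) :
    ∑ δ ∈ connectionSet f g, φ δ = ∑ t, ∑ s ∈ Finset.univ.erase 0,
      φ fun i => (scalePoly g i).eval s * (directionPoly f i).eval t := by
  rw [connectionSet, Finset.sum_image, Finset.sum_product]
  rintro ⟨t, s⟩ hs ⟨t', s'⟩ - h
  have h0 := congrFun h ⟨0, by omega⟩
  have h1 := congrFun h ⟨1, by omega⟩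
  simp only [scalePoly, directionPoly, if_true, one_ne_zero, if_false, eval_X, eval_one, mul_one,
    Nat.zero_lt_two, Nat.one_lt_two] at h0 h1
  subst h0
  have hs0 : s ≠ 0 := by simpa using hs
  rw [mul_left_cancel₀ hs0 h1]

end ConnectionSet

section Graph

variable {F : Type} [Field F] [Fintype F] [DecidableEq F] {k : ℕ} {f g : Fin k → F[X]}
  {p : ℕ} [Fact p.Prime] [CharP F p] {G : SimpleGraph (Fin k → F)} {m n : ℕ}

theorem abs_secondLargestEig_le [DecidableRel G.Adj] (hk : 3 ≤ k)
    (hG : ∀ a b, G.Adj a b ↔ b - a ∈ connectionSet f g)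
    (hm : 1 ≤ m) (hf : ∀ i : Fin k, 2 ≤ (i : ℕ) → (f i).natDegree ≤ m)
    (hn : 1 ≤ n) (hg : ∀ i : Fin k, 2 ≤ (i : ℕ) → (g i).natDegree ≤ n) (hnp : n < p)
    (hcoeff : ∀ w : Fin k → F, w ≠ 0 →
      ∃ j, 0 < j ∧ fiberCoeff (directionPoly f) (scalePoly g) w j ≠ 0)
    (hA : (G.adjMatrix ℝ).IsHermitian) :
    |secondLargestEig hA| ≤ m * Fintype.card F + n * (Fintype.card F * √(Fintype.card F)) := by
  obtain ⟨ψ, hψ, hfrob⟩ := exists_addChar_ne_one_pow_char F p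
  have hV : 3 ≤ Fintype.card (Fin k → F) := by
    rw [Fintype.card_fun, Fintype.card_fin]
    have h2 : 2 ≤ Fintype.card F := Fintype.one_lt_card
    calc 3 ≤ 2 ^ 3 := by norm_num
      _ ≤ 2 ^ k := Nat.pow_le_pow_right (by norm_num) hk
      _ ≤ Fintype.card F ^ k := Nat.pow_le_pow_left h2 k
  refine abs_secondLargestEig_le_of_norm_sum_addChar_le hG hA hV fun χ hχ => ?_
  obtain ⟨w, hw, hχw⟩ := exists_addChar_apply_eq_sum_mul hψ hχ
  obtain ⟨j, hj, hwj⟩ := hcoeff w hw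
  have := norm_sum_addChar_fiberPoly_le hψ hfrob (natDegree_directionPoly_le hm hf)
    (natDegree_scalePoly_le hn hg) hnp hj hwj
  simpa only [sum_connectionSet hk, hχw, eval_fiberPoly] using this

theorem connected_of_connectionSet
    (hG : ∀ a b, G.Adj a b ↔ b - a ∈ connectionSet f g)
    (hm : 1 ≤ m) (hf : ∀ i : Fin k, 2 ≤ (i : ℕ) → (f i).natDegree ≤ m) (hmq : m < Fintype.card F)
    (hn : 1 ≤ n) (hg : ∀ i : Fin k, 2 ≤ (i : ℕ) → (g i).natDegree ≤ n) (hnp : n < p)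
    (hcoeff : ∀ w : Fin k → F, w ≠ 0 →
      ∃ j, 0 < j ∧ fiberCoeff (directionPoly f) (scalePoly g) w j ≠ 0)
    (hF : (∀ i : Fin k, 2 ≤ (i : ℕ) → (g i).eval 0 = 0) ∨ (n ≤ 1 ∧ 3 ≤ Fintype.card F)) :
    G.Connected := by
  classical
  obtain ⟨ψ, hψ, -⟩ := exists_addChar_ne_one_pow_char F p
  refine connected_of_exists_addChar_ne_one hG fun χ hχ => ?_
  obtain ⟨w, hw, hχw⟩ := exists_addChar_apply_eq_sum_mul hψ hχ
  obtain ⟨j, hj, hwj⟩ := hcoeff w hw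
  obtain ⟨s, t, hs, hne⟩ := exists_addChar_fiberPoly_ne_one hψ (natDegree_directionPoly_le hm hf)
    hmq (natDegree_scalePoly_le hn hg) hnp hj hwj (hF.imp_left fun h i => by
      rw [scalePoly]
      split_ifs with hi
      · simp
      · exact h i (by omega))
  refine ⟨fun i => (scalePoly g i).eval s * (directionPoly f i).eval t,
    Finset.mem_image.2 ⟨(t, s), by simpa using hs, rfl⟩, ?_⟩
  rwa [hχw, ← eval_fiberPoly]

end Graph

section Assembly

theorem card_le_of_linearIndependent_of_natDegree_lt {F ι : Type*} [Field F] [Fintype ι]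
    {u : ι → F[X]} (hu : LinearIndependent F u) {n : ℕ} (hn : ∀ i, (u i).natDegree < n) :
    Fintype.card ι ≤ n := by
  have hmem : ∀ i, u i ∈ degreeLT F n := fun i =>
    mem_degreeLT.2 (degree_le_natDegree.trans_lt (by exact_mod_cast hn i))
  have hli : LinearIndependent F fun i => (⟨u i, hmem i⟩ : degreeLT F n) :=
    LinearIndependent.of_comp (degreeLT F n).subtype hu
  have := Module.Finite.equiv (degreeLTEquiv F n).symm
  have := hli.fintype_card_le_finrank
  rwa [(degreeLTEquiv F n).finrank_eq, Module.finrank_fin_fun] at this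

theorem eval_zero_eq_zero_of_comp_neg_X {F : Type*} [Field F] (h2 : (2 : F) ≠ 0) {h : F[X]}
    (hodd : h.comp (-X) = -h) : h.eval 0 = 0 := by
  have := congrArg (eval 0) hodd
  simp only [eval_comp, eval_neg, eval_X, neg_zero] at this
  have h0 : 2 * h.eval 0 = 0 := by linear_combination this
  exact (mul_eq_zero.1 h0).resolve_left h2

end Assembly

/-- under the degree conditions and one of the two linear-independence
conditions, the graphs `S(k,q_m)` are connected and `λ_2(S(k,q_m))/q_m² → 0`. -/
theorem stmt_9 (k : ℕ) (hk : 3 ≤ k)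
    (p e q : ℕ → ℕ) (hp : ∀ m, (p m).Prime) (he : ∀ m, 1 ≤ e m)
    (hq : ∀ m, q m = p m ^ e m) (hmono : StrictMono q)
    (F : ℕ → Type) [∀ m, Field (F m)] [∀ m, Fintype (F m)] [∀ m, DecidableEq (F m)]
    (hcard : ∀ m, Fintype.card (F m) = q m)
    (f g : ∀ m, Fin k → Polynomial (F m))
    (hdegf : ∀ m, ∀ i : Fin k, 2 ≤ (i : ℕ) → (f m i).natDegree ≤ q m - 1)
    (hdegg : ∀ m, ∀ i : Fin k, 2 ≤ (i : ℕ) → (g m i).natDegree ≤ q m - 1)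
    (hodd : ∀ m, ∀ i : Fin k, 2 ≤ (i : ℕ) → (g m i).comp (-Polynomial.X) = -(g m i))
    (G : ∀ m, SimpleGraph (Fin k → F m)) [∀ m, DecidableRel (G m).Adj]
    (hAdj : ∀ m, ∀ a b : Fin k → F m, (G m).Adj a b ↔
      (a ⟨0, by omega⟩ ≠ b ⟨0, by omega⟩ ∧ ∀ i : Fin k, 2 ≤ (i : ℕ) →
        b i - a i = (g m i).eval (b ⟨0, by omega⟩ - a ⟨0, by omega⟩) *
          (f m i).eval ((b ⟨1, by omega⟩ - a ⟨1, by omega⟩) / (b ⟨0, by omega⟩ - a ⟨0, by omega⟩))))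
    (df dg : ℕ → ℕ)
    (hdf : ∀ m, df m = (Finset.univ.filter (fun i : Fin k => 2 ≤ (i : ℕ))).sup
      (fun i => (f m i).natDegree))
    (hdg : ∀ m, dg m = (Finset.univ.filter (fun i : Fin k => 2 ≤ (i : ℕ))).sup
      (fun i => (g m i).natDegree))
    (hdf1 : ∀ m, 1 ≤ df m) (hdg1 : ∀ m, 1 ≤ dg m) (hdgp : ∀ m, dg m < p m)
    (hdfq : Filter.Tendsto (fun m => (df m : ℝ) / (q m : ℝ)) Filter.atTop (nhds 0))
    (hdgq : Filter.Tendsto (fun m => (dg m : ℝ) / Real.sqrt (q m)) Filter.atTop (nhds 0))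
    (hcond : ∀ m,
      (LinearIndependent (F m) (fun i : Fin k =>
          if (i : ℕ) = 0 then (1 : Polynomial (F m))
          else if (i : ℕ) = 1 then Polynomial.X
          else f m i) ∧
        ∀ i : Fin k, 2 ≤ (i : ℕ) → (g m i).coeff 1 ≠ 0) ∨
      (LinearIndependent (F m) (fun i : {i : Fin k // 2 ≤ (i : ℕ)} => f m i) ∧
        ∃ j, 2 ≤ j ∧ j ≤ dg m ∧ ∀ i : Fin k, 2 ≤ (i : ℕ) → (g m i).coeff j ≠ 0))
    (hA : ∀ m, ((G m).adjMatrix ℝ).IsHermitian) :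
    (∀ m, (G m).Connected) ∧
      Filter.Tendsto (fun m => secondLargestEig (hA m) / (q m : ℝ) ^ 2)
        Filter.atTop (nhds 0) := by
  have hfact : ∀ m, Fact (p m).Prime := fun m => ⟨hp m⟩
  have hchar : ∀ m, CharP (F m) (p m) := fun m =>
    charP_of_card_eq_prime_pow (by rw [hcard, hq])
  have hfdeg : ∀ m, ∀ i : Fin k, 2 ≤ (i : ℕ) → (f m i).natDegree ≤ df m := fun m i hi => by
    rw [hdf]
    exact Finset.le_sup (f := fun i => (f m i).natDegree) (by simpa using hi)
  have hgdeg : ∀ m, ∀ i : Fin k, 2 ≤ (i : ℕ) → (g m i).natDegree ≤ dg m := fun m i hi => by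
    rw [hdg]
    exact Finset.le_sup (f := fun i => (g m i).natDegree) (by simpa using hi)
  have hqpos : ∀ m, 0 < q m := fun m => hcard m ▸ Fintype.card_pos
  have hdflt : ∀ m, df m < Fintype.card (F m) := fun m => by
    have hle : df m ≤ q m - 1 := by
      rw [hdf]
      exact Finset.sup_le fun i hi => hdegf m i (by simpa using hi)
    have := hqpos m
    rw [hcard]
    omega
  have hG : ∀ m, ∀ a b, (G m).Adj a b ↔ b - a ∈ connectionSet (f m) (g m) := fun m a b => by
    rw [hAdj, mem_connectionSet (by omega) (by omega)]
    simp only [Pi.sub_apply, sub_ne_zero]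
    rw [ne_comm]
  have hcoeff : ∀ m, ∀ w : Fin k → F m, w ≠ 0 →
      ∃ j, 0 < j ∧ fiberCoeff (directionPoly (f m)) (scalePoly (g m)) w j ≠ 0 := fun m w hw =>
    exists_fiberCoeff_ne_zero hk ((hcond m).imp_right fun ⟨h, j, hj, _, hj'⟩ => ⟨h, j, hj, hj'⟩) hw
  refine ⟨fun m => ?_, ?_⟩
  · refine connected_of_connectionSet (hG m) (hdf1 m) (hfdeg m) (hdflt m) (hdg1 m) (hgdeg m)
      (hdgp m) (hcoeff m) ?_
    by_cases h2 : p m = 2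
    · refine Or.inr ⟨by have := hdgp m; omega, ?_⟩
      rcases hcond m with ⟨hli, -⟩ | ⟨-, j, hj, hj', -⟩
      · have := card_le_of_linearIndependent_of_natDegree_lt (u := directionPoly (f m)) hli
          fun i => (natDegree_directionPoly_le (hdf1 m) (hfdeg m) i).trans_lt (hdflt m)
        rw [Fintype.card_fin] at this
        exact hk.trans this
      · have := hdgp m
        omega
    · refine Or.inl fun i hi => eval_zero_eq_zero_of_comp_neg_X ?_ (hodd m i hi)
      exact Ring.two_ne_zero (by rwa [ringChar.eq (F m) (p m)])
  · refine squeeze_zero_norm (fun m => ?_) (by simpa using hdfq.add hdgq)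
    have hbound := abs_secondLargestEig_le hk (hG m) (hdf1 m) (hfdeg m) (hdg1 m) (hgdeg m) (hdgp m)
      (hcoeff m) (hA m)
    rw [hcard] at hbound
    have hq0 : (0 : ℝ) < q m := by exact_mod_cast hqpos m
    have hs0 : 0 < √(q m : ℝ) := Real.sqrt_pos.2 hq0
    have hs : √(q m : ℝ) * √(q m : ℝ) = q m := Real.mul_self_sqrt hq0.le
    rw [Real.norm_eq_abs, abs_div, abs_of_pos (pow_pos hq0 2), div_le_iff₀ (pow_pos hq0 2)]
    refine hbound.trans_eq ?_
    have h1 : (df m : ℝ) / q m * (q m : ℝ) ^ 2 = df m * q m := by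
      field_simp
    have h2 : (dg m : ℝ) / √(q m) * (q m : ℝ) ^ 2 = dg m * (q m * √(q m)) := by
      rw [div_mul_eq_mul_div, div_eq_iff hs0.ne']
      linear_combination -(dg m : ℝ) * q m * hs
    rw [add_mul, h1, h2]
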